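/- arXiv:math/9811014 — 2 statements merged into one kernel-verified Lean document; each statement's English description precedes it below -/
import Mathlib

section
/- For every integer n ≥ 2 there exist a smooth tangent vector field X on the unit sphere S^{2n+1} ⊂ ℝ^{2n+2} with no zeros and no periodic orbits, and a flow φ : ℝ × S^{2n+1} → S^{2n+1} of X (φ₀ = id, φ_{s+t} = φ_s ∘ φ_t, and for each x the curve t ↦ φ_t(x) is differentiable with derivative X(φ_t(x))) such that every map φ_t preserves some finite Borel measure on S^{2n+1} that is positive on every nonempty open subset. (Volume-preserving aperiodic flow on S^{2n+1}, 2n+1 ≥ 5, after Katok via a divergence-free Wilson plug.) -/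
open scoped RealInnerProductSpace
open MeasureTheory

noncomputable section

open Set Filter Topology
open scoped NNReal

section GlobalFlow

variable {E : Type*} [NormedAddCommGroup E] [NormedSpace ℝ E]

/-- A bounded Lipschitz vector field has solutions on every interval `[-T, T]`. -/
theorem exists_solution_Icc_of_lipschitz_of_bounded [CompleteSpace E] {v : E → E} {K L : ℝ≥0}
    (hv : LipschitzWith K v) (hb : ∀ x, ‖v x‖ ≤ L) (x : E) (T : ℝ) (hT : 0 < T) :
    ∃ γ : ℝ → E, γ 0 = x ∧ ∀ t ∈ Ioo (-T) T, HasDerivAt γ (v (γ t)) t := by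
  have h0 : (0 : ℝ) ∈ Icc (-T) T := ⟨by linarith, hT.le⟩
  have hP : IsPicardLindelof (fun _ => v) (⟨0, h0⟩ : Icc (-T) T) x (L * T.toNNReal) 0 L K :=
    IsPicardLindelof.of_time_independent (fun x _ => hb x) hv.lipschitzOnWith
      (by simp [Real.coe_toNNReal T hT.le])
  obtain ⟨γ, h1, h2⟩ := hP.exists_eq_forall_mem_Icc_hasDerivWithinAt₀
  exact ⟨γ, h1, fun t ht => (h2 t (Ioo_subset_Icc_self ht)).hasDerivAt (Icc_mem_nhds ht.1 ht.2)⟩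

/-- A bounded Lipschitz vector field has global solutions. -/
theorem exists_global_solution_of_lipschitz_of_bounded [CompleteSpace E] {v : E → E} {K L : ℝ≥0}
    (hv : LipschitzWith K v) (hb : ∀ x, ‖v x‖ ≤ L) (x : E) :
    ∃ γ : ℝ → E, γ 0 = x ∧ ∀ t, HasDerivAt γ (v (γ t)) t := by
  choose γ h0 hd using fun n : ℕ =>
    exists_solution_Icc_of_lipschitz_of_bounded hv hb x (n + 1) (by positivity)
  have agree : ∀ (m n : ℕ) (t : ℝ), |t| < m + 1 → |t| < n + 1 → γ m t = γ n t := by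
    have key : ∀ (m n : ℕ), m ≤ n → ∀ t : ℝ, |t| < m + 1 → γ m t = γ n t := by
      intro m n hmn t ht
      have hmn' : (m : ℝ) ≤ n := by exact_mod_cast hmn
      refine ODE_solution_unique_of_mem_Ioo (v := fun _ => v) (s := fun _ => univ) (K := K)
        (a := -(m + 1 : ℝ)) (b := m + 1) (t₀ := 0) (fun _ _ => hv.lipschitzOnWith)
        ⟨by linarith [m.cast_nonneg (α := ℝ)], by positivity⟩
        (fun t ht => ⟨hd m t ht, trivial⟩)
        (fun t ht => ⟨hd n t ⟨by linarith [ht.1], by linarith [ht.2]⟩, trivial⟩)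
        (by rw [h0, h0]) (abs_lt.1 ht)
    intro m n t hm hn
    rcases le_total m n with h | h
    · exact key m n h t hm
    · exact (key n m h t hn).symm
  refine ⟨fun t => γ ⌈|t|⌉₊ t, by simp [h0], fun t => ?_⟩
  have hlt : |t| < (⌈|t|⌉₊ : ℝ) + 1 := by linarith [Nat.le_ceil |t|]
  have hev : (fun s => γ ⌈|s|⌉₊ s) =ᶠ[𝓝 t] γ ⌈|t|⌉₊ := by
    filter_upwards [(continuous_abs.isOpen_preimage _ isOpen_Iio).mem_nhds hlt] with s hs
    exact agree _ _ s (by linarith [Nat.le_ceil |s|]) hs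
  exact (hd _ t (abs_lt.1 hlt)).congr_of_eventuallyEq hev

/-- Two solutions of the same autonomous Lipschitz equation depend Lipschitz continuously on their
initial values. -/
theorem dist_solution_le {v : E → E} {K : ℝ≥0} (hv : LipschitzWith K v) {γ δ : ℝ → E}
    (hγ : ∀ t, HasDerivAt γ (v (γ t)) t) (hδ : ∀ t, HasDerivAt δ (v (δ t)) t) (t : ℝ) :
    dist (γ t) (δ t) ≤ dist (γ 0) (δ 0) * Real.exp (K * |t|) := by
  have key : ∀ (w : E → E), LipschitzWith K w → ∀ (γ δ : ℝ → E),
      (∀ t, HasDerivAt γ (w (γ t)) t) → (∀ t, HasDerivAt δ (w (δ t)) t) → ∀ t, 0 ≤ t →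
      dist (γ t) (δ t) ≤ dist (γ 0) (δ 0) * Real.exp (K * t) := by
    intro w hw γ δ hγ hδ t ht
    simpa using dist_le_of_trajectories_ODE (v := fun _ => w) (K := K) (a := 0) (b := t)
      (fun _ => hw)
      (fun s _ => (hγ s).continuousAt.continuousWithinAt) (fun s _ => (hγ s).hasDerivWithinAt)
      (fun s _ => (hδ s).continuousAt.continuousWithinAt) (fun s _ => (hδ s).hasDerivWithinAt)
      le_rfl t ⟨ht, le_rfl⟩
  rcases le_total 0 t with ht | ht
  · simpa [abs_of_nonneg ht] using key v hv γ δ hγ hδ t ht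
  · have hneg : ∀ {β : ℝ → E}, (∀ t, HasDerivAt β (v (β t)) t) →
        ∀ t, HasDerivAt (fun s => β (-s)) (-v (β (-t))) t := by
      intro β hβ t
      simpa [Function.comp_def] using (hβ (-t)).scomp t (hasDerivAt_neg t)
    simpa [abs_of_nonpos ht] using
      key (fun x => -v x) hv.neg (fun s => γ (-s)) (fun s => δ (-s)) (hneg hγ) (hneg hδ) (-t)
        (by linarith)

/-- Solutions of an autonomous Lipschitz equation are determined by one value. -/
theorem solution_eq_of_lipschitz {v : E → E} {K : ℝ≥0} (hv : LipschitzWith K v) {γ δ : ℝ → E}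
    (hγ : ∀ t, HasDerivAt γ (v (γ t)) t) (hδ : ∀ t, HasDerivAt δ (v (δ t)) t) {t₀ : ℝ}
    (h : γ t₀ = δ t₀) : γ = δ :=
  ODE_solution_unique_univ (v := fun _ => v) (s := fun _ => univ) (K := K)
    (fun _ => hv.lipschitzOnWith) (fun t => ⟨hγ t, trivial⟩) (fun t => ⟨hδ t, trivial⟩) h

/-- The global flow of a bounded Lipschitz vector field. -/
theorem exists_flow_of_lipschitz_of_bounded [CompleteSpace E] {v : E → E} {K L : ℝ≥0}
    (hv : LipschitzWith K v) (hb : ∀ x, ‖v x‖ ≤ L) :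
    ∃ φ : ℝ → E → E, (∀ x, φ 0 x = x) ∧ (∀ s t x, φ (s + t) x = φ s (φ t x)) ∧
      (∀ x t, HasDerivAt (fun τ => φ τ x) (v (φ t x)) t) ∧ ∀ t, ∃ C, LipschitzWith C (φ t) := by
  choose γ h0 hd using exists_global_solution_of_lipschitz_of_bounded hv hb
  refine ⟨fun t x => γ x t, h0, fun s t x => ?_, hd, fun t =>
    ⟨(Real.exp (K * |t|)).toNNReal, LipschitzWith.of_dist_le_mul fun x y => ?_⟩⟩
  · have := solution_eq_of_lipschitz hv (γ := fun s => γ x (s + t)) (δ := γ (γ x t)) (t₀ := 0)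
      (fun s => (hd x (s + t)).comp_add_const s t) (hd _) (by simp [h0])
    exact congrFun this s
  · have := dist_solution_le hv (hd x) (hd y) t
    rw [h0, h0] at this
    rwa [Real.coe_toNNReal _ (Real.exp_pos _).le, mul_comm]

/-- A compactly supported `C¹` map is Lipschitz and bounded. -/
theorem ContDiff.exists_lipschitz_bounded_of_hasCompactSupport {F : Type*} [NormedAddCommGroup F]
    [NormedSpace ℝ F] {v : E → F} (hv : ContDiff ℝ 1 v) (hs : HasCompactSupport v) :
    (∃ K, LipschitzWith K v) ∧ ∃ L : ℝ≥0, ∀ x, ‖v x‖ ≤ L := by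
  obtain ⟨K, hK⟩ := (hv.continuous_fderiv one_ne_zero).bounded_above_of_compact_support
    (hs.fderiv ℝ)
  obtain ⟨L, hL⟩ := hv.continuous.bounded_above_of_compact_support hs
  exact ⟨⟨K.toNNReal, lipschitzWith_of_nnnorm_fderiv_le (hv.differentiable one_ne_zero)
    fun x => by simpa using Real.toNNReal_le_toNNReal (hK x)⟩,
    L.toNNReal, fun x => (hL x).trans (Real.le_coe_toNNReal L)⟩

end GlobalFlow

namespace AperiodicSphere

open Complex (I normSq)

/-! ### The profile functions of the plug -/

/-- A smooth function which is positive on `(0, ∞)`, vanishes at `0`, dominates the identity on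
`[0, 1]` and is `1` on `[1, ∞)`. -/
def ramp (v : ℝ) : ℝ := v + (1 - v) * Real.smoothTransition v

/-- The level function of the plug in terms of the transverse invariant `s` and the height `θ`. -/
def level (s θ : ℝ) : ℝ := 16 * s + 4 * (θ ^ 2 - 1 / 4) ^ 2

/-- The factor by which the plug slows down the motion along the base field. -/
def speed (s θ : ℝ) : ℝ := ramp (level s θ)

/-- The angular velocity of the rotation in the plug; it is odd in the height `θ`. -/
def spin (s θ : ℝ) : ℝ := θ * (1 - Real.smoothTransition (level s θ))

theorem ramp_of_one_le {v : ℝ} (h : 1 ≤ v) : ramp v = 1 := by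
  simp [ramp, Real.smoothTransition.one_of_one_le h]

theorem le_ramp {v : ℝ} (h : v ≤ 1) : v ≤ ramp v := by
  have := mul_nonneg (sub_nonneg.2 h) (Real.smoothTransition.nonneg v)
  simp only [ramp]; linarith

theorem ramp_pos {v : ℝ} (h : 0 < v) : 0 < ramp v := by
  rcases le_total 1 v with h1 | h1
  · simp [ramp_of_one_le h1]
  · exact h.trans_le (le_ramp h1)

theorem ramp_zero : ramp 0 = 0 := by simp [ramp]

theorem contDiff_ramp : ContDiff ℝ (⊤ : ℕ∞) ramp := by
  unfold ramp
  exact contDiff_id.add ((contDiff_const.sub contDiff_id).mul Real.smoothTransition.contDiff)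

theorem contDiff_speed : ContDiff ℝ (⊤ : ℕ∞) fun p : ℝ × ℝ => speed p.1 p.2 := by
  unfold speed level
  exact contDiff_ramp.comp (by fun_prop)

theorem contDiff_spin : ContDiff ℝ (⊤ : ℕ∞) fun p : ℝ × ℝ => spin p.1 p.2 := by
  unfold spin level
  exact contDiff_snd.mul (contDiff_const.sub (Real.smoothTransition.contDiff.comp (by fun_prop)))

theorem level_nonneg {s : ℝ} (hs : 0 ≤ s) (θ : ℝ) : 0 ≤ level s θ := by
  unfold level; positivity

theorem one_le_level_of_le {s : ℝ} (hs : 1 / 16 ≤ s) (θ : ℝ) : 1 ≤ level s θ := by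
  unfold level; nlinarith [sq_nonneg (θ ^ 2 - 1 / 4)]

theorem one_le_level_of_one_le_abs {s : ℝ} (hs : 0 ≤ s) {θ : ℝ} (hθ : 1 ≤ |θ|) :
    1 ≤ level s θ := by
  have : 1 ≤ θ ^ 2 := by rw [← sq_abs]; nlinarith
  unfold level; nlinarith

theorem speed_of_one_le {s θ : ℝ} (h : 1 ≤ level s θ) : speed s θ = 1 := ramp_of_one_le h

theorem spin_of_one_le {s θ : ℝ} (h : 1 ≤ level s θ) : spin s θ = 0 := by
  simp [spin, Real.smoothTransition.one_of_one_le h]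

theorem speed_nonneg {s : ℝ} (hs : 0 ≤ s) (θ : ℝ) : 0 ≤ speed s θ := by
  rcases (level_nonneg hs θ).eq_or_lt with h | h
  · rw [speed, ← h, ramp_zero]
  · exact (ramp_pos h).le

theorem speed_pos {s : ℝ} (hs : 0 < s) (θ : ℝ) : 0 < speed s θ :=
  ramp_pos (by unfold level; positivity)

theorem speed_neg (s θ : ℝ) : speed s (-θ) = speed s θ := by simp [speed, level]

theorem spin_neg (s θ : ℝ) : spin s (-θ) = -spin s θ := by simp [spin, level]

theorem abs_spin_le (s θ : ℝ) : |spin s θ| ≤ |θ| := by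
  rw [spin, abs_mul]
  have h1 := Real.smoothTransition.nonneg (level s θ)
  have h2 := Real.smoothTransition.le_one (level s θ)
  exact mul_le_of_le_one_right (abs_nonneg θ) (abs_le.2 ⟨by linarith, by linarith⟩)

theorem level_zero_eq_zero_iff {θ : ℝ} : level 0 θ = 0 ↔ θ = 1 / 2 ∨ θ = -(1 / 2) := by
  have : level 0 θ = 4 * ((θ - 1 / 2) * (θ - -(1 / 2))) ^ 2 := by unfold level; ring
  rw [this]
  simp [sub_eq_zero]
  grind

theorem speed_zero_pos {θ : ℝ} (h1 : θ ≠ 1 / 2) (h2 : θ ≠ -(1 / 2)) : 0 < speed 0 θ :=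
  ramp_pos <| (level_nonneg le_rfl θ).lt_of_ne fun h =>
    (level_zero_eq_zero_iff.1 h.symm).elim h1 h2

theorem speed_zero_half : speed 0 (1 / 2) = 0 := by
  rw [speed, level_zero_eq_zero_iff.2 (Or.inl rfl), ramp_zero]

theorem speed_zero_neg_half : speed 0 (-(1 / 2)) = 0 := by rw [speed_neg, speed_zero_half]

theorem spin_zero_half : spin 0 (1 / 2) = 1 / 2 := by
  rw [spin, level_zero_eq_zero_iff.2 (Or.inl rfl)]; simp

theorem spin_zero_neg_half : spin 0 (-(1 / 2)) = -(1 / 2) := by rw [spin_neg, spin_zero_half]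

/-! ### Frequencies and rotations -/

variable {n : ℕ}

/-- The frequencies of the linear base flow; their ratios are irrational. -/
def freq (i : Fin (n + 1)) : ℝ := 1 + (i : ℕ) * √2

theorem freq_pos (i : Fin (n + 1)) : 0 < freq i := by unfold freq; positivity

/-- The frequencies relative to the frequency of the coordinate `j`. -/
def ratio (j i : Fin (n + 1)) : ℝ := freq i / freq j

theorem ratio_self (j : Fin (n + 1)) : ratio j j = 1 := div_self (freq_pos j).ne'

theorem ratio_mul (j i : Fin (n + 1)) : ratio j i * freq j = freq i :=
  div_mul_cancel₀ _ (freq_pos j).ne'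

theorem eq_of_freq_mul_eq {i i' : Fin (n + 1)} {m m' : ℤ} (hm : m ≠ 0)
    (h : freq i * m' = freq i' * m) : i = i' := by
  have hirr : Irrational (√2 : ℝ) := irrational_sqrt_two
  have h1 : ((i : ℕ) * m' - (i' : ℕ) * m : ℤ) * √2 = ((m - m' : ℤ) : ℝ) := by
    push_cast; simp only [freq] at h; linarith
  have h2 : ((i : ℕ) * m' - (i' : ℕ) * m : ℤ) = 0 := by
    by_contra h3
    exact (hirr.intCast_mul h3).ne_int _ h1
  rw [h2] at h1
  have h3 : m - m' = 0 := by
    have : ((m - m' : ℤ) : ℝ) = 0 := by rw [← h1]; simp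
    exact_mod_cast this
  obtain rfl : m = m' := by omega
  have : ((i : ℕ) : ℤ) = (i' : ℕ) := by
    rw [← sub_mul] at h2
    rcases mul_eq_zero.1 h2 with h | h
    · omega
    · exact absurd h hm
  exact Fin.ext (by exact_mod_cast this)

/-- The angular velocities of the rotation of the plug around the closed orbit `j`. -/
def rotFreq (j i : Fin (n + 1)) : ℝ := if i = j + 1 then 1 else if i = j + 2 then √2 else 0

theorem add_one_ne (hn : 2 ≤ n) (j : Fin (n + 1)) : j + 1 ≠ j := by
  obtain ⟨m, rfl⟩ := Nat.exists_eq_add_of_le hn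
  intro h
  have := (add_eq_left.1 h)
  simp at this

theorem add_two_ne (hn : 2 ≤ n) (j : Fin (n + 1)) : j + 2 ≠ j := by
  obtain ⟨m, rfl⟩ := Nat.exists_eq_add_of_le hn
  intro h
  have := (add_eq_left.1 h)
  simp only [Fin.ext_iff, Fin.coe_ofNat_eq_mod] at this
  rw [Nat.mod_eq_of_lt (by omega)] at this
  simp at this

theorem add_two_ne_add_one (hn : 2 ≤ n) (j : Fin (n + 1)) : j + 2 ≠ j + 1 := by
  obtain ⟨m, rfl⟩ := Nat.exists_eq_add_of_le hn
  intro h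
  have := (add_left_cancel h)
  simp only [Fin.ext_iff, Fin.coe_ofNat_eq_mod] at this
  rw [Nat.mod_eq_of_lt (by omega), Nat.mod_eq_of_lt (by omega)] at this
  simp at this

theorem rotFreq_self (hn : 2 ≤ n) (j : Fin (n + 1)) : rotFreq j j = 0 := by
  simp [rotFreq, (add_one_ne hn j).symm, (add_two_ne hn j).symm]

/-- Rotation by the angle `b` of the transverse coordinates around the centre `-1/4`. -/
def rot (j : Fin (n + 1)) (b : ℝ) (y : Fin (n + 1) → ℂ) : Fin (n + 1) → ℂ :=
  fun i => Complex.exp (rotFreq j i * b * I) * (y i + 1 / 4) - 1 / 4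

theorem rot_zero (j : Fin (n + 1)) (y : Fin (n + 1) → ℂ) : rot j 0 y = y := by
  ext i; simp [rot]

theorem rot_rot (j : Fin (n + 1)) (b c : ℝ) (y : Fin (n + 1) → ℂ) :
    rot j b (rot j c y) = rot j (b + c) y := by
  ext i
  simp only [rot, sub_add_cancel]
  rw [← mul_assoc, ← Complex.exp_add]
  push_cast; ring_nf

/-- The transverse invariant of the plug: it vanishes exactly on the invariant torus. -/
def excess (j : Fin (n + 1)) (y : Fin (n + 1) → ℂ) : ℝ :=
  ∑ i ∈ Finset.univ.erase j,
    if i = j + 1 ∨ i = j + 2 then (normSq (y i + 1 / 4) - 1 / 16) ^ 2 else normSq (y i)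

theorem excess_term_nonneg (j i : Fin (n + 1)) (y : Fin (n + 1) → ℂ) :
    0 ≤ if i = j + 1 ∨ i = j + 2 then (normSq (y i + 1 / 4) - 1 / 16) ^ 2 else normSq (y i) := by
  split_ifs
  · positivity
  · exact Complex.normSq_nonneg _

theorem excess_nonneg (j : Fin (n + 1)) (y : Fin (n + 1) → ℂ) : 0 ≤ excess j y :=
  Finset.sum_nonneg fun i _ => excess_term_nonneg j i y

theorem term_le_excess {j i : Fin (n + 1)} (h : i ≠ j) (y : Fin (n + 1) → ℂ) :
    (if i = j + 1 ∨ i = j + 2 then (normSq (y i + 1 / 4) - 1 / 16) ^ 2 else normSq (y i))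
      ≤ excess j y :=
  Finset.single_le_sum
    (f := fun i => if i = j + 1 ∨ i = j + 2 then (normSq (y i + 1 / 4) - 1 / 16) ^ 2
      else normSq (y i)) (fun i _ => excess_term_nonneg j i y) (Finset.mem_erase.2 ⟨h, by simp⟩)

theorem excess_zero (j : Fin (n + 1)) : excess j 0 = 0 := by
  refine Finset.sum_eq_zero fun i _ => ?_
  split_ifs <;> norm_num [Complex.normSq_apply]

theorem continuous_excess (j : Fin (n + 1)) : Continuous (excess j) := by
  unfold excess
  refine continuous_finsetSum _ fun i _ => ?_
  split_ifs <;> fun_prop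

theorem contDiff_excess (j : Fin (n + 1)) : ContDiff ℝ (⊤ : ℕ∞) (excess j) := by
  unfold excess
  refine ContDiff.sum fun i _ => ?_
  simp only [Complex.normSq_eq_norm_sq]
  split_ifs
  · exact (((((contDiff_apply ℝ ℂ i).add contDiff_const).norm_sq ℝ)).sub contDiff_const).pow 2
  · exact (contDiff_apply ℝ ℂ i).norm_sq ℝ

theorem excess_rot (j : Fin (n + 1)) (b : ℝ) (y : Fin (n + 1) → ℂ) :
    excess j (rot j b y) = excess j y := by
  refine Finset.sum_congr rfl fun i _ => ?_
  split_ifs with h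
  · have h1 : normSq (Complex.exp (rotFreq j i * b * I)) = 1 := by
      rw [Complex.normSq_eq_norm_sq, ← Complex.ofReal_mul, Complex.norm_exp_ofReal_mul_I, one_pow]
    simp [rot, h1]
  · push Not at h
    simp [rot, rotFreq, h.1, h.2]

theorem norm_lt_of_excess_le {j i : Fin (n + 1)} (hi : i ≠ j) {y : Fin (n + 1) → ℂ}
    (h : excess j y ≤ 1 / 16) : ‖y i‖ < 9 / 10 := by
  have h1 := (term_le_excess hi y).trans h
  split_ifs at h1
  · rw [Complex.normSq_eq_norm_sq] at h1
    have h2 : ‖y i + 1 / 4‖ ^ 2 ≤ 5 / 16 := by nlinarith [sq_nonneg (‖y i + 1 / 4‖ ^ 2 - 5 / 16)]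
    have h3 : ‖y i + 1 / 4‖ < 6 / 10 := by nlinarith [norm_nonneg (y i + 1 / 4)]
    calc ‖y i‖ = ‖(y i + 1 / 4) - 1 / 4‖ := by ring_nf
      _ ≤ ‖y i + 1 / 4‖ + ‖(1 / 4 : ℂ)‖ := norm_sub_le _ _
      _ < 9 / 10 := by norm_num at h3 ⊢; linarith
  · rw [Complex.normSq_eq_norm_sq] at h1
    nlinarith [norm_nonneg (y i)]

theorem norm_lt_one_of_excess_le {j i : Fin (n + 1)} (hi : i ≠ j) {y : Fin (n + 1) → ℂ}
    (h : excess j y ≤ 1 / 16) : ‖y i‖ < 1 :=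
  (norm_lt_of_excess_le hi h).trans (by norm_num)

/-- On the zero set of the transverse invariant the rotated coordinates do not vanish. -/
theorem norm_add_of_excess_eq_zero {j i : Fin (n + 1)} (hj : i ≠ j) (hi : i = j + 1 ∨ i = j + 2)
    {y : Fin (n + 1) → ℂ} (h : excess j y = 0) : y i + 1 / 4 ≠ 0 := by
  have h1 := (term_le_excess hj y).trans h.le
  rw [if_pos hi] at h1
  intro h0
  rw [h0] at h1
  norm_num at h1

/-! ### The vector field -/

/-- The transverse coordinates of `z` in the flow box around the closed orbit `j`. -/
def slow (j : Fin (n + 1)) (z : EuclideanSpace ℂ (Fin (n + 1))) : Fin (n + 1) → ℂ :=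
  fun i => z i * Complex.exp (-(ratio j i * (z j).arg) * I) / ‖z j‖

/-- The point `z` lies in the support of the plug around the closed orbit `j`. -/
def Active (j : Fin (n + 1)) (z : EuclideanSpace ℂ (Fin (n + 1))) : Prop :=
  z j ≠ 0 ∧ |(z j).arg| < 1 ∧ excess j (slow j z) < 1 / 16

open Classical in
/-- The change of the speed along the base field caused by the plug `j`. -/
def defect (j : Fin (n + 1)) (z : EuclideanSpace ℂ (Fin (n + 1))) : ℝ :=
  if Active j z then speed (excess j (slow j z)) (z j).arg - 1 else 0

open Classical in
/-- The angular velocity of the rotation in the plug `j`. -/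
def twist (j : Fin (n + 1)) (z : EuclideanSpace ℂ (Fin (n + 1))) : ℝ :=
  if Active j z then spin (excess j (slow j z)) (z j).arg else 0

/-- The speed of the modified field along the base field. -/
def total (z : EuclideanSpace ℂ (Fin (n + 1))) : ℝ := 1 + ∑ j, defect j z

/-- The modified field before the projection to spheres. -/
def raw (z : EuclideanSpace ℂ (Fin (n + 1))) : EuclideanSpace ℂ (Fin (n + 1)) :=
  WithLp.toLp 2 fun i => total z * (I * freq i * z i) + ∑ j, twist j z * (I * rotFreq j i *
    (z i + 1 / 4 * (‖z j‖ * Complex.exp (ratio j i * (z j).arg * I))))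

/-- A smooth cutoff supported in an annulus around the unit sphere. -/
def cutoff (r : ℝ) : ℝ :=
  Real.smoothTransition (4 * r - 1) * (1 - Real.smoothTransition (r - 2))

/-- The vector field of the theorem: the projection of `raw` to the spheres around the origin, cut
off away from the unit sphere. -/
def field (z : EuclideanSpace ℂ (Fin (n + 1))) : EuclideanSpace ℂ (Fin (n + 1)) :=
  cutoff (‖z‖ ^ 2) • (‖z‖ ^ 2 • raw z - ⟪z, raw z⟫ • z)

theorem inner_field (z : EuclideanSpace ℂ (Fin (n + 1))) : ⟪field z, z⟫ = 0 := by
  rw [field, real_inner_smul_left, inner_sub_left, real_inner_smul_left, real_inner_smul_left,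
    real_inner_self_eq_norm_sq, real_inner_comm]
  ring

theorem field_of_norm_eq_one {z : EuclideanSpace ℂ (Fin (n + 1))} (hz : ‖z‖ = 1) :
    field z = raw z - ⟪z, raw z⟫ • z := by
  have h1 : Real.smoothTransition (4 - 1) = 1 :=
    Real.smoothTransition.one_of_one_le (by norm_num)
  have h2 : Real.smoothTransition (1 - 2) = 0 :=
    Real.smoothTransition.zero_of_nonpos (by norm_num)
  simp [field, cutoff, hz, h1, h2]

theorem one_le_level_of_not_active {j : Fin (n + 1)} {z : EuclideanSpace ℂ (Fin (n + 1))}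
    (hz : z j ≠ 0) (h : ¬ Active j z) : 1 ≤ level (excess j (slow j z)) (z j).arg := by
  by_cases h1 : |(z j).arg| < 1
  · refine one_le_level_of_le ?_ _
    by_contra! h2
    exact h ⟨hz, h1, h2⟩
  · exact one_le_level_of_one_le_abs (excess_nonneg _ _) (not_lt.1 h1)

theorem speed_of_not_active {j : Fin (n + 1)} {z : EuclideanSpace ℂ (Fin (n + 1))} (hz : z j ≠ 0)
    (h : ¬ Active j z) : speed (excess j (slow j z)) (z j).arg = 1 :=
  speed_of_one_le (one_le_level_of_not_active hz h)

theorem spin_of_not_active {j : Fin (n + 1)} {z : EuclideanSpace ℂ (Fin (n + 1))} (hz : z j ≠ 0)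
    (h : ¬ Active j z) : spin (excess j (slow j z)) (z j).arg = 0 :=
  spin_of_one_le (one_le_level_of_not_active hz h)

theorem defect_of_ne_zero {j : Fin (n + 1)} {z : EuclideanSpace ℂ (Fin (n + 1))} (hz : z j ≠ 0) :
    defect j z = speed (excess j (slow j z)) (z j).arg - 1 := by
  by_cases h : Active j z
  · simp [defect, h]
  · simp [defect, h, speed_of_not_active hz h]

theorem twist_of_ne_zero {j : Fin (n + 1)} {z : EuclideanSpace ℂ (Fin (n + 1))} (hz : z j ≠ 0) :
    twist j z = spin (excess j (slow j z)) (z j).arg := by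
  by_cases h : Active j z
  · simp [twist, h]
  · simp [twist, h, spin_of_not_active hz h]

theorem norm_exp_neg_mul_I (a b : ℝ) : ‖Complex.exp (-(a * b) * I)‖ = 1 := by
  rw [← Complex.ofReal_mul, ← Complex.ofReal_neg, Complex.norm_exp_ofReal_mul_I]

theorem norm_exp_mul_mul_I (a b : ℝ) : ‖Complex.exp (a * b * I)‖ = 1 := by
  rw [← Complex.ofReal_mul, Complex.norm_exp_ofReal_mul_I]

theorem norm_slow (j i : Fin (n + 1)) (z : EuclideanSpace ℂ (Fin (n + 1))) :
    ‖slow j z i‖ = ‖z i‖ / ‖z j‖ := by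
  rw [slow, norm_div, norm_mul, norm_exp_neg_mul_I]
  simp

theorem Active.norm_lt_mul {j i : Fin (n + 1)} {z : EuclideanSpace ℂ (Fin (n + 1))}
    (h : Active j z) (hi : i ≠ j) : ‖z i‖ < 9 / 10 * ‖z j‖ := by
  have := norm_lt_of_excess_le hi h.2.2.le
  rwa [norm_slow, div_lt_iff₀ (norm_pos_iff.2 h.1)] at this

theorem Active.norm_lt {j i : Fin (n + 1)} {z : EuclideanSpace ℂ (Fin (n + 1))}
    (h : Active j z) (hi : i ≠ j) : ‖z i‖ < ‖z j‖ :=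
  (h.norm_lt_mul hi).trans_le (by linarith [norm_nonneg (z j)])

theorem Active.eq {j i : Fin (n + 1)} {z : EuclideanSpace ℂ (Fin (n + 1))}
    (h : Active j z) (h' : Active i z) : i = j := by
  by_contra hne
  exact (h.norm_lt hne).not_gt (h'.norm_lt (Ne.symm hne))

theorem total_of_forall_not_active {z : EuclideanSpace ℂ (Fin (n + 1))}
    (h : ∀ j, ¬ Active j z) : total z = 1 := by
  simp [total, defect, h]

theorem total_of_forall_ne {z : EuclideanSpace ℂ (Fin (n + 1))} {j : Fin (n + 1)}
    (h : ∀ k ≠ j, ¬ Active k z) : total z = 1 + defect j z := by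
  rw [total, Finset.sum_eq_single j (fun k _ hk => by simp [defect, h k hk]) (by simp)]

theorem raw_of_forall_not_active {z : EuclideanSpace ℂ (Fin (n + 1))}
    (h : ∀ j, ¬ Active j z) (i : Fin (n + 1)) : raw z i = I * freq i * z i := by
  simp [raw, total_of_forall_not_active h, twist, h]

theorem raw_of_forall_ne {z : EuclideanSpace ℂ (Fin (n + 1))} {j : Fin (n + 1)}
    (h : ∀ k ≠ j, ¬ Active k z) (i : Fin (n + 1)) :
    raw z i = (1 + defect j z) * (I * freq i * z i) + twist j z * (I * rotFreq j i *
      (z i + 1 / 4 * (‖z j‖ * Complex.exp (ratio j i * (z j).arg * I)))) := by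
  simp only [raw, total_of_forall_ne h]
  rw [Finset.sum_eq_single j (fun k _ hk => by simp [twist, h k hk]) (by simp)]
  push_cast; rfl

theorem slow_smul (j : Fin (n + 1)) {r : ℝ} (hr : 0 < r) (z : EuclideanSpace ℂ (Fin (n + 1))) :
    slow j (r • z) = slow j z := by
  ext i
  have : (r : ℂ) ≠ 0 := by exact_mod_cast hr.ne'
  simp only [slow, PiLp.smul_apply, Complex.real_smul, Complex.arg_real_mul _ hr, norm_mul,
    Complex.norm_real, Real.norm_of_nonneg hr.le]
  push_cast
  rw [mul_assoc, mul_div_mul_left _ _ this]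

theorem active_smul (j : Fin (n + 1)) {r : ℝ} (hr : 0 < r) (z : EuclideanSpace ℂ (Fin (n + 1))) :
    Active j (r • z) ↔ Active j z := by
  simp [Active, slow_smul j hr, Complex.arg_real_mul _ hr, hr.ne']

theorem defect_smul (j : Fin (n + 1)) {r : ℝ} (hr : 0 < r) (z : EuclideanSpace ℂ (Fin (n + 1))) :
    defect j (r • z) = defect j z := by
  simp only [defect, slow_smul j hr, PiLp.smul_apply, Complex.real_smul,
    Complex.arg_real_mul _ hr]
  by_cases h : Active j z
  · rw [if_pos h, if_pos ((active_smul j hr z).2 h)]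
  · rw [if_neg h, if_neg (mt (active_smul j hr z).1 h)]

theorem twist_smul (j : Fin (n + 1)) {r : ℝ} (hr : 0 < r) (z : EuclideanSpace ℂ (Fin (n + 1))) :
    twist j (r • z) = twist j z := by
  simp only [twist, slow_smul j hr, PiLp.smul_apply, Complex.real_smul,
    Complex.arg_real_mul _ hr]
  by_cases h : Active j z
  · rw [if_pos h, if_pos ((active_smul j hr z).2 h)]
  · rw [if_neg h, if_neg (mt (active_smul j hr z).1 h)]

theorem raw_smul {r : ℝ} (hr : 0 < r) (z : EuclideanSpace ℂ (Fin (n + 1))) :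
    raw (r • z) = r • raw z := by
  ext i
  simp only [raw, total, defect_smul _ hr, twist_smul _ hr, PiLp.smul_apply, Complex.real_smul,
    Complex.arg_real_mul _ hr, norm_mul, Complex.norm_real, Real.norm_of_nonneg hr.le, mul_add,
    Finset.mul_sum]
  push_cast
  congr 1
  · ring
  · exact Finset.sum_congr rfl fun j _ => by ring

theorem total_pos_or (z : EuclideanSpace ℂ (Fin (n + 1))) :
    total z = 1 ∨ ∃ j, Active j z ∧ total z = speed (excess j (slow j z)) (z j).arg := by
  by_cases h : ∃ j, Active j z
  · obtain ⟨j, hj⟩ := h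
    refine Or.inr ⟨j, hj, ?_⟩
    rw [total_of_forall_ne fun k hk h => hk (hj.eq h), defect_of_ne_zero hj.1]
    ring
  · exact Or.inl (total_of_forall_not_active (not_exists.1 h))

/-! ### Smoothness of the vector field -/

theorem eventually_not_active {j : Fin (n + 1)} {z : EuclideanSpace ℂ (Fin (n + 1))} (hz : z ≠ 0)
    (hj : z j ∉ Complex.slitPlane) : ∀ᶠ w in 𝓝 z, ¬ Active j w := by
  have hc : ∀ i, Continuous fun w : EuclideanSpace ℂ (Fin (n + 1)) => w i := fun i => by fun_prop
  by_cases h0 : z j = 0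
  · obtain ⟨i, hi⟩ : ∃ i, z i ≠ 0 := by
      by_contra! h
      exact hz (by ext i; simpa using h i)
    have hij : i ≠ j := fun h => hi (h ▸ h0)
    have : ∀ᶠ w in 𝓝 z, ‖w j‖ < ‖w i‖ :=
      ((hc j).norm.continuousAt.eventually_lt (hc i).norm.continuousAt (by simpa [h0] using hi))
    filter_upwards [this] with w hw h
    exact hw.not_gt (h.norm_lt hij)
  · have hre : (z j).re < 0 := by
      rw [Complex.mem_slitPlane_iff] at hj
      push Not at hj
      refine hj.1.lt_of_ne fun h => h0 (Complex.ext h hj.2)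
    have : ∀ᶠ w in 𝓝 z, (w j).re < 0 :=
      (Complex.continuous_re.comp (hc j)).continuousAt.eventually_lt continuousAt_const hre
    filter_upwards [this] with w hw h
    have h1 : |(w j).arg| ≤ Real.pi / 2 := h.2.1.le.trans (by linarith [Real.pi_gt_three])
    exact hw.not_ge (Complex.abs_arg_le_pi_div_two_iff.1 h1)

theorem contDiffAt_arg_apply {j : Fin (n + 1)} {z : EuclideanSpace ℂ (Fin (n + 1))}
    (hj : z j ∈ Complex.slitPlane) :
    ContDiffAt ℝ (⊤ : ℕ∞) (fun w : EuclideanSpace ℂ (Fin (n + 1)) => (w j).arg) z := by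
  have h1 : ContDiffAt ℝ (⊤ : ℕ∞) Complex.log (z j) :=
    (Complex.contDiffAt_log hj).restrict_scalars ℝ
  have h2 : ContDiffAt ℝ (⊤ : ℕ∞) (fun w : EuclideanSpace ℂ (Fin (n + 1)) => w j) z := by fun_prop
  simp only [← Complex.log_im]
  exact (Complex.imCLM.contDiff.contDiffAt.comp _ (h1.comp z h2))

theorem contDiffAt_norm_apply {j : Fin (n + 1)} {z : EuclideanSpace ℂ (Fin (n + 1))}
    (hj : z j ≠ 0) :
    ContDiffAt ℝ (⊤ : ℕ∞) (fun w : EuclideanSpace ℂ (Fin (n + 1)) => ‖w j‖) z := by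
  have h2 : ContDiffAt ℝ (⊤ : ℕ∞) (fun w : EuclideanSpace ℂ (Fin (n + 1)) => w j) z := by fun_prop
  exact h2.norm ℝ hj

theorem ContDiffAt.exp_mul_I {f : EuclideanSpace ℂ (Fin (n + 1)) → ℝ}
    {z : EuclideanSpace ℂ (Fin (n + 1))} (h : ContDiffAt ℝ (⊤ : ℕ∞) f z) :
    ContDiffAt ℝ (⊤ : ℕ∞) (fun w => Complex.exp (f w * I)) z :=
  ((Complex.ofRealCLM.contDiff.contDiffAt.comp z h).mul contDiffAt_const).cexp

theorem contDiffAt_excess_slow {j : Fin (n + 1)} {z : EuclideanSpace ℂ (Fin (n + 1))}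
    (hj : z j ∈ Complex.slitPlane) :
    ContDiffAt ℝ (⊤ : ℕ∞) (fun w : EuclideanSpace ℂ (Fin (n + 1)) => excess j (slow j w)) z := by
  have h0 : z j ≠ 0 := Complex.slitPlane_ne_zero hj
  refine (contDiff_excess j).contDiffAt.comp z (contDiffAt_pi.2 fun i => ?_)
  have h2 : ContDiffAt ℝ (⊤ : ℕ∞) (fun w : EuclideanSpace ℂ (Fin (n + 1)) => w i) z := by fun_prop
  have h3 : ContDiffAt ℝ (⊤ : ℕ∞) (fun w : EuclideanSpace ℂ (Fin (n + 1)) =>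
      Complex.exp (((-(ratio j i * (w j).arg) : ℝ) : ℂ) * I)) z :=
    ContDiffAt.exp_mul_I ((contDiffAt_const.mul (contDiffAt_arg_apply hj)).neg)
  have h4 : ContDiffAt ℝ (⊤ : ℕ∞) (fun w : EuclideanSpace ℂ (Fin (n + 1)) => ((‖w j‖ : ℝ) : ℂ)) z :=
    Complex.ofRealCLM.contDiff.contDiffAt.comp z (contDiffAt_norm_apply h0)
  have h5 := (h2.mul h3).mul (h4.inv (by simpa using h0))
  refine h5.congr_of_eventuallyEq (Eventually.of_forall fun w => ?_)
  simp only [slow, Complex.ofReal_neg, Complex.ofReal_mul, div_eq_mul_inv, Pi.inv_apply]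

theorem contDiffAt_defect (j : Fin (n + 1)) {z : EuclideanSpace ℂ (Fin (n + 1))} (hz : z ≠ 0) :
    ContDiffAt ℝ (⊤ : ℕ∞) (defect j) z := by
  by_cases hj : z j ∈ Complex.slitPlane
  · have h1 : ContDiffAt ℝ (⊤ : ℕ∞) (fun w : EuclideanSpace ℂ (Fin (n + 1)) =>
        speed (excess j (slow j w)) (w j).arg - 1) z :=
      ((contDiff_speed.contDiffAt.comp z ((contDiffAt_excess_slow hj).prodMk
        (contDiffAt_arg_apply hj)))).sub contDiffAt_const
    have h2 : ∀ᶠ w : EuclideanSpace ℂ (Fin (n + 1)) in 𝓝 z, w j ≠ 0 :=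
      (show Continuous fun w : EuclideanSpace ℂ (Fin (n + 1)) => w j by fun_prop).continuousAt
        |>.eventually_ne (Complex.slitPlane_ne_zero hj)
    exact h1.congr_of_eventuallyEq (h2.mono fun w hw => defect_of_ne_zero hw)
  · exact (contDiffAt_const (c := (0 : ℝ))).congr_of_eventuallyEq
      ((eventually_not_active hz hj).mono fun w hw => by simp [defect, hw])

theorem contDiffAt_twist_mul (j i : Fin (n + 1)) {z : EuclideanSpace ℂ (Fin (n + 1))}
    (hz : z ≠ 0) :
    ContDiffAt ℝ (⊤ : ℕ∞) (fun w : EuclideanSpace ℂ (Fin (n + 1)) =>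
      twist j w * (I * rotFreq j i *
        (w i + 1 / 4 * (‖w j‖ * Complex.exp (ratio j i * (w j).arg * I))))) z := by
  by_cases hj : z j ∈ Complex.slitPlane
  · have h0 : z j ≠ 0 := Complex.slitPlane_ne_zero hj
    have h1 : ContDiffAt ℝ (⊤ : ℕ∞) (fun w : EuclideanSpace ℂ (Fin (n + 1)) =>
        ((spin (excess j (slow j w)) (w j).arg : ℝ) : ℂ)) z :=
      Complex.ofRealCLM.contDiff.contDiffAt.comp z
      ((contDiff_spin.contDiffAt.comp z ((contDiffAt_excess_slow hj).prodMk
        (contDiffAt_arg_apply hj))))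
    have h2 : ∀ᶠ w : EuclideanSpace ℂ (Fin (n + 1)) in 𝓝 z, w j ≠ 0 :=
      (show Continuous fun w : EuclideanSpace ℂ (Fin (n + 1)) => w j by fun_prop).continuousAt
        |>.eventually_ne h0
    have h3 : ContDiffAt ℝ (⊤ : ℕ∞) (fun w : EuclideanSpace ℂ (Fin (n + 1)) => w i) z := by
      fun_prop
    have h4 : ContDiffAt ℝ (⊤ : ℕ∞) (fun w : EuclideanSpace ℂ (Fin (n + 1)) =>
        Complex.exp (((ratio j i * (w j).arg : ℝ) : ℂ) * I)) z :=
      ContDiffAt.exp_mul_I (contDiffAt_const.mul (contDiffAt_arg_apply hj))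
    have h5 : ContDiffAt ℝ (⊤ : ℕ∞)
        (fun w : EuclideanSpace ℂ (Fin (n + 1)) => ((‖w j‖ : ℝ) : ℂ)) z :=
      Complex.ofRealCLM.contDiff.contDiffAt.comp z (contDiffAt_norm_apply h0)
    have h6 := h1.mul ((contDiffAt_const (c := I * rotFreq j i)).mul
      (h3.add ((contDiffAt_const (c := (1 / 4 : ℂ))).mul (h5.mul h4))))
    refine h6.congr_of_eventuallyEq (h2.mono fun w hw => ?_)
    simp only [twist_of_ne_zero hw]
    push_cast; rfl
  · exact (contDiffAt_const (c := (0 : ℂ))).congr_of_eventuallyEq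
      ((eventually_not_active hz hj).mono fun w hw => by simp [twist, hw])

theorem contDiffAt_raw {z : EuclideanSpace ℂ (Fin (n + 1))} (hz : z ≠ 0) :
    ContDiffAt ℝ (⊤ : ℕ∞) raw z := by
  refine contDiffAt_piLp' 2 fun i => ?_
  have h1 : ContDiffAt ℝ (⊤ : ℕ∞) (fun w : EuclideanSpace ℂ (Fin (n + 1)) => (total w : ℂ)) z :=
    Complex.ofRealCLM.contDiff.contDiffAt.comp z
      (contDiffAt_const.add (ContDiffAt.sum fun j _ => contDiffAt_defect j hz))
  have h3 : ContDiffAt ℝ (⊤ : ℕ∞) (fun w : EuclideanSpace ℂ (Fin (n + 1)) => w i) z := by fun_prop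
  exact (h1.mul (contDiffAt_const.mul h3)).add
    (ContDiffAt.sum fun j _ => contDiffAt_twist_mul j i hz)

theorem cutoff_of_le {r : ℝ} (h : r ≤ 1 / 4) : cutoff r = 0 := by
  rw [cutoff, Real.smoothTransition.zero_of_nonpos (by linarith), zero_mul]

theorem cutoff_of_ge {r : ℝ} (h : 3 ≤ r) : cutoff r = 0 := by
  rw [cutoff, Real.smoothTransition.one_of_one_le (x := r - 2) (by linarith), sub_self, mul_zero]

theorem contDiff_cutoff : ContDiff ℝ (⊤ : ℕ∞) cutoff :=
  (Real.smoothTransition.contDiff.comp (by fun_prop)).mul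
    (contDiff_const.sub (Real.smoothTransition.contDiff.comp (by fun_prop)))

theorem contDiff_field : ContDiff ℝ (⊤ : ℕ∞) (field (n := n)) := by
  refine contDiff_iff_contDiffAt.2 fun z => ?_
  by_cases hz : z = 0
  · subst hz
    refine (contDiffAt_const (c := (0 : EuclideanSpace ℂ (Fin (n + 1))))).congr_of_eventuallyEq ?_
    have : ∀ᶠ w : EuclideanSpace ℂ (Fin (n + 1)) in 𝓝 0, ‖w‖ ^ 2 < 1 / 4 :=
      (continuous_norm.pow 2).continuousAt.eventually_lt continuousAt_const (by simp)
    filter_upwards [this] with w hw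
    simp [field, cutoff_of_le hw.le]
  · have h1 : ContDiffAt ℝ (⊤ : ℕ∞) (fun w : EuclideanSpace ℂ (Fin (n + 1)) => ‖w‖ ^ 2) z :=
      (contDiff_norm_sq ℝ).contDiffAt
    exact (contDiff_cutoff.contDiffAt.comp z h1).smul ((h1.smul (contDiffAt_raw hz)).sub
      ((contDiffAt_id.inner ℝ (contDiffAt_raw hz)).smul contDiffAt_id))

theorem hasCompactSupport_field : HasCompactSupport (field (n := n)) := by
  refine HasCompactSupport.intro (isCompact_closedBall (0 : EuclideanSpace ℂ (Fin (n + 1))) 2)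
    fun z hz => ?_
  have : 2 < ‖z‖ := by simpa using hz
  rw [field, cutoff_of_ge (by nlinarith), zero_smul]

/-! ### Flow boxes around the closed orbits of the base flow -/

/-- The parametrization of the flow box around the closed orbit `j`, before normalization: the point
with transverse coordinates `y` is moved along the base flow until its coordinate `j` has argument
`θ`. The coordinate `y j` is ignored. -/
def lift (j : Fin (n + 1)) (θ : ℝ) (y : Fin (n + 1) → ℂ) : EuclideanSpace ℂ (Fin (n + 1)) :=
  WithLp.toLp 2 fun i => Complex.exp (ratio j i * θ * I) * if i = j then 1 else y i

/-- The parametrization of the flow box around the closed orbit `j`. -/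
def chart (j : Fin (n + 1)) (θ : ℝ) (y : Fin (n + 1) → ℂ) : EuclideanSpace ℂ (Fin (n + 1)) :=
  ‖lift j θ y‖⁻¹ • lift j θ y

theorem lift_apply_self (j : Fin (n + 1)) (θ : ℝ) (y : Fin (n + 1) → ℂ) :
    lift j θ y j = Complex.exp (θ * I) := by
  simp [lift, ratio_self]

theorem lift_apply_of_ne {j i : Fin (n + 1)} (h : i ≠ j) (θ : ℝ) (y : Fin (n + 1) → ℂ) :
    lift j θ y i = Complex.exp (ratio j i * θ * I) * y i := by
  simp [lift, h]

theorem norm_lift_apply_self (j : Fin (n + 1)) (θ : ℝ) (y : Fin (n + 1) → ℂ) :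
    ‖lift j θ y j‖ = 1 := by
  rw [lift_apply_self, Complex.norm_exp_ofReal_mul_I]

theorem norm_lift_apply_of_ne {j i : Fin (n + 1)} (h : i ≠ j) (θ : ℝ) (y : Fin (n + 1) → ℂ) :
    ‖lift j θ y i‖ = ‖y i‖ := by
  rw [lift_apply_of_ne h, norm_mul, norm_exp_mul_mul_I, one_mul]

theorem lift_apply_self_ne_zero (j : Fin (n + 1)) (θ : ℝ) (y : Fin (n + 1) → ℂ) :
    lift j θ y j ≠ 0 := by
  rw [← norm_pos_iff, norm_lift_apply_self]; exact one_pos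

theorem lift_ne_zero (j : Fin (n + 1)) (θ : ℝ) (y : Fin (n + 1) → ℂ) : lift j θ y ≠ 0 :=
  fun h => lift_apply_self_ne_zero j θ y (by simp [h])

theorem norm_chart (j : Fin (n + 1)) (θ : ℝ) (y : Fin (n + 1) → ℂ) : ‖chart j θ y‖ = 1 :=
  norm_smul_inv_norm (𝕜 := ℝ) (lift_ne_zero j θ y)

theorem arg_lift {j : Fin (n + 1)} {θ : ℝ} (hθ : θ ∈ Ioc (-Real.pi) Real.pi)
    (y : Fin (n + 1) → ℂ) : (lift j θ y j).arg = θ := by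
  rw [lift_apply_self, Complex.arg_exp_mul_I, toIocMod_eq_self]
  convert hθ using 1; ring_nf

theorem slow_lift {j i : Fin (n + 1)} {θ : ℝ} (hθ : θ ∈ Ioc (-Real.pi) Real.pi)
    (y : Fin (n + 1) → ℂ) (hi : i ≠ j) : slow j (lift j θ y) i = y i := by
  rw [slow, arg_lift hθ, norm_lift_apply_self, lift_apply_of_ne hi, mul_right_comm,
    ← Complex.exp_add]
  simp

theorem excess_congr {j : Fin (n + 1)} {y y' : Fin (n + 1) → ℂ} (h : ∀ i ≠ j, y i = y' i) :
    excess j y = excess j y' :=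
  Finset.sum_congr rfl fun i hi => by rw [h i (Finset.ne_of_mem_erase hi)]

theorem lift_congr {j : Fin (n + 1)} {y y' : Fin (n + 1) → ℂ} (h : ∀ i ≠ j, y i = y' i) (θ : ℝ) :
    lift j θ y = lift j θ y' := by
  ext i
  by_cases hi : i = j
  · simp [lift, hi]
  · simp [lift, hi, h i hi]

theorem chart_congr {j : Fin (n + 1)} {y y' : Fin (n + 1) → ℂ} (h : ∀ i ≠ j, y i = y' i) (θ : ℝ) :
    chart j θ y = chart j θ y' := by
  rw [chart, chart, lift_congr h]

theorem inv_norm_lift_pos (j : Fin (n + 1)) (θ : ℝ) (y : Fin (n + 1) → ℂ) :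
    0 < ‖lift j θ y‖⁻¹ := inv_pos.2 (norm_pos_iff.2 (lift_ne_zero j θ y))

theorem chart_apply_self_ne_zero (j : Fin (n + 1)) (θ : ℝ) (y : Fin (n + 1) → ℂ) :
    chart j θ y j ≠ 0 := by
  simp [chart, lift_apply_self_ne_zero j θ y, lift_ne_zero j θ y]

theorem arg_chart {j : Fin (n + 1)} {θ : ℝ} (hθ : θ ∈ Ioc (-Real.pi) Real.pi)
    (y : Fin (n + 1) → ℂ) : (chart j θ y j).arg = θ := by
  rw [chart, PiLp.smul_apply, Complex.real_smul, Complex.arg_real_mul _ (inv_norm_lift_pos j θ y),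
    arg_lift hθ]

theorem slow_chart {j i : Fin (n + 1)} {θ : ℝ} (hθ : θ ∈ Ioc (-Real.pi) Real.pi)
    (y : Fin (n + 1) → ℂ) (hi : i ≠ j) : slow j (chart j θ y) i = y i := by
  rw [chart, slow_smul j (inv_norm_lift_pos j θ y), slow_lift hθ y hi]

theorem excess_slow_chart {j : Fin (n + 1)} {θ : ℝ} (hθ : θ ∈ Ioc (-Real.pi) Real.pi)
    (y : Fin (n + 1) → ℂ) : excess j (slow j (chart j θ y)) = excess j y :=
  excess_congr fun _ hi => slow_chart hθ y hi

theorem excess_slow_lift {j : Fin (n + 1)} {θ : ℝ} (hθ : θ ∈ Ioc (-Real.pi) Real.pi)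
    (y : Fin (n + 1) → ℂ) : excess j (slow j (lift j θ y)) = excess j y :=
  excess_congr fun _ hi => slow_lift hθ y hi

theorem chart_arg_slow {j : Fin (n + 1)} {z : EuclideanSpace ℂ (Fin (n + 1))} (hz : ‖z‖ = 1)
    (hj : z j ≠ 0) : chart j (z j).arg (slow j z) = z := by
  have hj' : (‖z j‖ : ℂ) ≠ 0 := by simpa using hj
  have h1 : lift j (z j).arg (slow j z) = ‖z j‖⁻¹ • z := by
    ext i
    rw [PiLp.smul_apply, Complex.real_smul]
    by_cases hi : i = j
    · subst hi
      rw [lift_apply_self]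
      conv_rhs => rw [← Complex.norm_mul_exp_arg_mul_I (z i)]
      push_cast
      rw [← mul_assoc]
      simp [hj]
    · rw [lift_apply_of_ne hi, slow]
      have : Complex.exp (ratio j i * (z j).arg * I) *
          Complex.exp (-(ratio j i * (z j).arg) * I) = 1 := by rw [← Complex.exp_add]; simp
      rw [Complex.ofReal_inv]
      linear_combination (z i) * (‖z j‖ : ℂ)⁻¹ * this
  rw [chart, h1, norm_smul, hz, mul_one, norm_inv, norm_norm, inv_inv, smul_smul,
    mul_inv_cancel₀ (norm_ne_zero_iff.2 hj), one_smul]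

theorem not_active_lift {j k : Fin (n + 1)} (hk : k ≠ j) {y : Fin (n + 1) → ℂ}
    (hy : ∀ i ≠ j, ‖y i‖ ≤ 1) (θ : ℝ) : ¬ Active k (lift j θ y) := fun h => by
  have h1 := h.norm_lt hk.symm
  rw [norm_lift_apply_self, norm_lift_apply_of_ne hk] at h1
  exact h1.not_ge (hy k hk)

theorem not_active_chart {j k : Fin (n + 1)} (hk : k ≠ j) {y : Fin (n + 1) → ℂ}
    (hy : ∀ i ≠ j, ‖y i‖ ≤ 1) (θ : ℝ) : ¬ Active k (chart j θ y) := by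
  rw [chart, active_smul k (inv_norm_lift_pos j θ y)]
  exact not_active_lift hk hy θ

theorem total_chart {j : Fin (n + 1)} {θ : ℝ} (hθ : θ ∈ Ioc (-Real.pi) Real.pi)
    {y : Fin (n + 1) → ℂ} (hy : ∀ i ≠ j, ‖y i‖ ≤ 1) :
    total (chart j θ y) = speed (excess j y) θ := by
  rw [total_of_forall_ne fun k hk => not_active_chart hk hy θ,
    defect_of_ne_zero (chart_apply_self_ne_zero j θ y), excess_slow_chart hθ, arg_chart hθ]
  ring

theorem raw_lift {j : Fin (n + 1)} {θ : ℝ} (hθ : θ ∈ Ioc (-Real.pi) Real.pi)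
    {y : Fin (n + 1) → ℂ} (hy : ∀ i ≠ j, ‖y i‖ ≤ 1) (i : Fin (n + 1)) :
    raw (lift j θ y) i = speed (excess j y) θ * (I * freq i * lift j θ y i) +
      spin (excess j y) θ * (I * rotFreq j i *
        (lift j θ y i + 1 / 4 * Complex.exp (ratio j i * θ * I))) := by
  rw [raw_of_forall_ne fun k hk => not_active_lift hk hy θ,
    defect_of_ne_zero (lift_apply_self_ne_zero j θ y),
    twist_of_ne_zero (lift_apply_self_ne_zero j θ y), excess_slow_lift hθ, arg_lift hθ,
    norm_lift_apply_self]
  push_cast; ring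

theorem hasDerivAt_piLp {f : ℝ → EuclideanSpace ℂ (Fin (n + 1))}
    {f' : EuclideanSpace ℂ (Fin (n + 1))} {t : ℝ} :
    HasDerivAt f f' t ↔ ∀ i, HasDerivAt (fun s => f s i) (f' i) t := by
  rw [← hasDerivAt_pi (φ := fun s => (f s).ofLp) (φ' := f'.ofLp)]
  have := (PiLp.continuousLinearEquiv 2 ℝ (fun _ : Fin (n + 1) => ℂ)).comp_hasFDerivAt_iff
    (f := f) (x := t) (f' := ContinuousLinearMap.toSpanSingleton ℝ f')
  rw [hasDerivAt_iff_hasFDerivAt, hasDerivAt_iff_hasFDerivAt, ← this]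
  refine iff_of_eq (congrArg₂ (HasFDerivAt · · t) rfl ?_)
  ext; simp

theorem HasDerivAt.normalize {q : ℝ → EuclideanSpace ℂ (Fin (n + 1))} {t : ℝ} (h0 : q t ≠ 0)
    (h : HasDerivAt q (raw (q t)) t) :
    HasDerivAt (fun s => ‖q s‖⁻¹ • q s) (field (‖q t‖⁻¹ • q t)) t := by
  have hpos : 0 < ‖q t‖ := norm_pos_iff.2 h0
  have h1 : HasDerivAt (fun s => ‖q s‖) (⟪q t, raw (q t)⟫ / ‖q t‖) t := by
    have h2 := (h.norm_sq).sqrt (by positivity)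
    simp only [Real.sqrt_sq (norm_nonneg _)] at h2
    convert h2 using 1
    field_simp
  have h3 := (h1.inv hpos.ne').smul h
  have h4 : ‖‖q t‖⁻¹ • q t‖ = 1 := norm_smul_inv_norm (𝕜 := ℝ) h0
  refine h3.congr_deriv ?_
  symm
  rw [field_of_norm_eq_one h4, raw_smul (inv_pos.2 hpos), real_inner_smul_left,
    real_inner_smul_right, smul_smul, sub_eq_add_neg, ← neg_smul, Pi.inv_apply]
  congr 2
  field_simp

theorem hasDerivAt_cexp_ofReal {f : ℝ → ℝ} {f' t : ℝ} (a : ℝ) (h : HasDerivAt f f' t) :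
    HasDerivAt (fun s => Complex.exp (a * f s * I)) (a * f' * I * Complex.exp (a * f t * I)) t := by
  have := (((h.ofReal_comp).const_mul (a : ℂ)).mul_const I).cexp
  convert this using 1
  ring

theorem hasDerivAt_rot {j : Fin (n + 1)} {β : ℝ → ℝ} {b t : ℝ} (h : HasDerivAt β b t)
    (y : Fin (n + 1) → ℂ) (i : Fin (n + 1)) :
    HasDerivAt (fun s => rot j (β s) y i) (rotFreq j i * b * I * (rot j (β t) y i + 1 / 4)) t := by
  refine (((hasDerivAt_cexp_ofReal (rotFreq j i) h).mul_const (y i + 1 / 4)).sub_const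
    (1 / 4)).congr_deriv ?_
  simp only [rot]; ring

/-- The field in the flow box: the height `θ` and the angle of rotation evolve by explicit scalar
equations. -/
theorem hasDerivAt_chart (hn : 2 ≤ n) {j : Fin (n + 1)} {ϑ β : ℝ → ℝ} {t : ℝ}
    {y : Fin (n + 1) → ℂ} (hθ : ϑ t ∈ Ioc (-Real.pi) Real.pi)
    (hy : ∀ i ≠ j, ‖rot j (β t) y i‖ ≤ 1)
    (h1 : HasDerivAt ϑ (freq j * speed (excess j y) (ϑ t)) t)
    (h2 : HasDerivAt β (spin (excess j y) (ϑ t)) t) :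
    HasDerivAt (fun s => chart j (ϑ s) (rot j (β s) y))
      (field (chart j (ϑ t) (rot j (β t) y))) t := by
  refine HasDerivAt.normalize (q := fun s => lift j (ϑ s) (rot j (β s) y))
    (lift_ne_zero _ _ _) (hasDerivAt_piLp.2 fun i => ?_)
  rw [raw_lift hθ hy, excess_rot]
  have hr : (ratio j i : ℂ) * freq j = freq i := by exact_mod_cast ratio_mul j i
  have h3 := hasDerivAt_cexp_ofReal (ratio j i) h1
  by_cases hi : i = j
  · subst hi
    simp only [lift_apply_self, rotFreq_self hn]
    simp only [ratio_self, Complex.ofReal_one, one_mul] at h3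
    refine h3.congr_deriv ?_
    push_cast; ring
  · simp only [lift_apply_of_ne hi]
    refine (h3.mul (hasDerivAt_rot h2 y i)).congr_deriv ?_
    rw [← hr]
    push_cast; ring

/-! ### Explicit solutions in the flow boxes -/

theorem exists_lipschitz_height (c : ℝ) {s : ℝ} (hs : 0 ≤ s) :
    (∃ K : ℝ≥0, LipschitzWith K fun θ => c * speed s θ) ∧
      ∃ L : ℝ≥0, ∀ θ, ‖c * speed s θ‖ ≤ L := by
  have h1 : ContDiff ℝ 1 fun θ => c * (1 - speed s θ) :=
    contDiff_const.mul (contDiff_const.sub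
      ((contDiff_speed.comp (contDiff_const.prodMk contDiff_id)).of_le (by simp)))
  have h2 : HasCompactSupport fun θ => c * (1 - speed s θ) := by
    refine HasCompactSupport.intro (isCompact_Icc (a := -1) (b := 1)) fun θ hθ => ?_
    have : 1 ≤ |θ| := by
      by_contra! h
      exact hθ ⟨(abs_lt.1 h).1.le, (abs_lt.1 h).2.le⟩
    simp [speed_of_one_le (one_le_level_of_one_le_abs hs this)]
  obtain ⟨⟨K, hK⟩, L, hL⟩ := ContDiff.exists_lipschitz_bounded_of_hasCompactSupport h1 h2
  have h3 : (fun θ => c * speed s θ) = fun θ => c - c * (1 - speed s θ) := by ext; ring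
  refine ⟨⟨0 + K, h3 ▸ (LipschitzWith.const c).sub hK⟩, ‖c‖₊ + L, fun θ => ?_⟩
  rw [congrFun h3 θ]
  exact (norm_sub_le _ _).trans (add_le_add le_rfl (hL θ))

theorem exists_height (c : ℝ) {s : ℝ} (hs : 0 ≤ s) (θ₀ : ℝ) :
    ∃ ϑ : ℝ → ℝ, ϑ 0 = θ₀ ∧ ∀ t, HasDerivAt ϑ (c * speed s (ϑ t)) t := by
  obtain ⟨⟨K, hK⟩, L, hL⟩ := exists_lipschitz_height c hs
  exact exists_global_solution_of_lipschitz_of_bounded hK hL θ₀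

theorem height_eq_const (c : ℝ) {s : ℝ} (hs : 0 ≤ s) {ϑ : ℝ → ℝ}
    (h : ∀ t, HasDerivAt ϑ (c * speed s (ϑ t)) t) {t : ℝ} (h0 : speed s (ϑ t) = 0) (t' : ℝ) :
    ϑ t' = ϑ t := by
  obtain ⟨⟨K, hK⟩, -⟩ := exists_lipschitz_height c hs
  have := solution_eq_of_lipschitz hK h (δ := fun _ => ϑ t) (t₀ := t)
    (fun t' => by simpa [h0] using hasDerivAt_const t' (ϑ t)) rfl
  exact congrFun this t'

theorem continuous_spin (s : ℝ) : Continuous (spin s) :=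
  contDiff_spin.continuous.comp (by fun_prop : Continuous fun θ : ℝ => (s, θ))

theorem continuous_speed (s : ℝ) : Continuous (speed s) :=
  contDiff_speed.continuous.comp (by fun_prop : Continuous fun θ : ℝ => (s, θ))

theorem exists_angle (s : ℝ) {ϑ : ℝ → ℝ} (hϑ : Continuous ϑ) :
    ∃ β : ℝ → ℝ, β 0 = 0 ∧ ∀ t, HasDerivAt β (spin s (ϑ t)) t :=
  ⟨fun t => ∫ u in (0 : ℝ)..t, spin s (ϑ u), by simp, fun t =>
    (((continuous_spin s).comp hϑ).integral_hasStrictDerivAt 0 t).hasDerivAt⟩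

theorem norm_rot_le {j : Fin (n + 1)} {ϑ β : ℝ → ℝ} {y : Fin (n + 1) → ℂ}
    (hy : ∀ i ≠ j, ‖y i‖ ≤ 1) (h0 : β 0 = 0)
    (hβ : ∀ t, HasDerivAt β (spin (excess j y) (ϑ t)) t) (t : ℝ) (i : Fin (n + 1)) (hi : i ≠ j) :
    ‖rot j (β t) y i‖ ≤ 1 := by
  by_cases hs : excess j y ≤ 1 / 16
  · exact (norm_lt_one_of_excess_le hi (by rwa [excess_rot])).le
  · have h1 : ∀ t, HasDerivAt β 0 t := fun t => by
      simpa [spin_of_one_le (one_le_level_of_le (not_le.1 hs).le (ϑ t))] using hβ t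
    have h2 : β t = 0 := by
      rw [← h0]
      exact is_const_of_deriv_eq_zero (fun t => (h1 t).differentiableAt)
        (fun t => (h1 t).deriv) t 0
    rw [h2, rot_zero]
    exact hy i hi

theorem exists_lipschitz_field :
    (∃ K : ℝ≥0, LipschitzWith K (field (n := n))) ∧
      ∃ L : ℝ≥0, ∀ z : EuclideanSpace ℂ (Fin (n + 1)), ‖field z‖ ≤ L :=
  ContDiff.exists_lipschitz_bounded_of_hasCompactSupport (contDiff_field.of_le (by simp))
    hasCompactSupport_field

theorem eqOn_Icc_of_solution {γ δ : ℝ → EuclideanSpace ℂ (Fin (n + 1))} {a b t₀ : ℝ}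
    (ht : t₀ ∈ Icc a b) (hγ : ∀ t ∈ Icc a b, HasDerivAt γ (field (γ t)) t)
    (hδ : ∀ t ∈ Icc a b, HasDerivAt δ (field (δ t)) t) (h : γ t₀ = δ t₀) : EqOn γ δ (Icc a b) := by
  obtain ⟨⟨K, hK⟩, -⟩ := exists_lipschitz_field (n := n)
  rw [← Icc_union_Icc_eq_Icc ht.1 ht.2]
  have h1 : Icc a t₀ ⊆ Icc a b := Icc_subset_Icc_right ht.2
  have h2 : Icc t₀ b ⊆ Icc a b := Icc_subset_Icc_left ht.1
  refine EqOn.union ?_ ?_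
  · exact ODE_solution_unique_of_mem_Icc_left (v := fun _ => field) (s := fun _ => univ) (K := K)
      (fun _ _ => hK.lipschitzOnWith)
      (fun t ht => (hγ t (h1 ht)).continuousAt.continuousWithinAt)
      (fun t ht => (hγ t (h1 (Ioc_subset_Icc_self ht))).hasDerivWithinAt) (fun _ _ => trivial)
      (fun t ht => (hδ t (h1 ht)).continuousAt.continuousWithinAt)
      (fun t ht => (hδ t (h1 (Ioc_subset_Icc_self ht))).hasDerivWithinAt) (fun _ _ => trivial) h
  · exact ODE_solution_unique_of_mem_Icc_right (v := fun _ => field) (s := fun _ => univ) (K := K)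
      (fun _ _ => hK.lipschitzOnWith)
      (fun t ht => (hγ t (h2 ht)).continuousAt.continuousWithinAt)
      (fun t ht => (hγ t (h2 (Ico_subset_Icc_self ht))).hasDerivWithinAt) (fun _ _ => trivial)
      (fun t ht => (hδ t (h2 ht)).continuousAt.continuousWithinAt)
      (fun t ht => (hδ t (h2 (Ico_subset_Icc_self ht))).hasDerivWithinAt) (fun _ _ => trivial) h

/-- As long as the height stays in `(-π, π)`, a solution starting in a flow box is given by the
explicit scalar equations. -/
theorem eqOn_chart (hn : 2 ≤ n) {j : Fin (n + 1)} {γ : ℝ → EuclideanSpace ℂ (Fin (n + 1))}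
    (hγ : ∀ t, HasDerivAt γ (field (γ t)) t) {ϑ β : ℝ → ℝ} {y : Fin (n + 1) → ℂ}
    (hy : ∀ i ≠ j, ‖y i‖ ≤ 1) (h0 : β 0 = 0)
    (hϑ : ∀ t, HasDerivAt ϑ (freq j * speed (excess j y) (ϑ t)) t)
    (hβ : ∀ t, HasDerivAt β (spin (excess j y) (ϑ t)) t) {t₀ a b : ℝ}
    (ht : (0 : ℝ) ∈ Icc a b) (hθ : ∀ t ∈ Icc a b, ϑ t ∈ Ioo (-Real.pi) Real.pi)
    (h : γ t₀ = chart j (ϑ 0) y) :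
    ∀ t ∈ Icc a b, γ (t₀ + t) = chart j (ϑ t) (rot j (β t) y) := by
  refine eqOn_Icc_of_solution (γ := fun t => γ (t₀ + t)) ht
    (fun t _ => (hγ (t₀ + t)).comp_const_add t₀ t)
    (fun t ht => hasDerivAt_chart hn ⟨(hθ t ht).1, (hθ t ht).2.le⟩ (norm_rot_le hy h0 hβ t)
      (hϑ t) (hβ t)) ?_
  simp [h0, rot_zero, h]

theorem chart_inj {j : Fin (n + 1)} {θ θ' : ℝ} (hθ : θ ∈ Ioc (-Real.pi) Real.pi)
    (hθ' : θ' ∈ Ioc (-Real.pi) Real.pi) {y y' : Fin (n + 1) → ℂ}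
    (h : chart j θ y = chart j θ' y') : θ = θ' ∧ ∀ i ≠ j, y i = y' i :=
  ⟨by rw [← arg_chart hθ y, h, arg_chart hθ'],
    fun i hi => by rw [← slow_chart hθ y hi, h, slow_chart hθ' y' hi]⟩

/-! ### The invariant tori of the plugs carry no periodic orbits -/

theorem not_periodic_of_height (hn : 2 ≤ n) {j : Fin (n + 1)}
    {γ : ℝ → EuclideanSpace ℂ (Fin (n + 1))} (hγ : ∀ t, HasDerivAt γ (field (γ t)) t) {ϑ : ℝ → ℝ}
    {y : Fin (n + 1) → ℂ} (hy : excess j y = 0)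
    (hϑ : ∀ t, HasDerivAt ϑ (freq j * speed 0 (ϑ t)) t) (h1 : ϑ 0 ≠ 1 / 2) (h2 : ϑ 0 ≠ -(1 / 2))
    {a b t₀ : ℝ} (hab : a < b) (hc : a = 0 ∨ b = 0)
    (hθ : ∀ t ∈ Icc a b, ϑ t ∈ Ioo (-Real.pi) Real.pi)
    (h : γ t₀ = chart j (ϑ 0) y) : γ (t₀ + a) ≠ γ (t₀ + b) := fun hp => by
  obtain ⟨β, hβ0, hβ⟩ := exists_angle 0 (continuous_iff_continuousAt.2 fun t => (hϑ t).continuousAt)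
  have hab' : (0 : ℝ) ∈ Icc a b := by rcases hc with rfl | rfl <;> simp [hab.le]
  have key := eqOn_chart hn hγ (fun i hi => (norm_lt_one_of_excess_le hi (by simp [hy])).le) hβ0
    (by rwa [hy]) (by rwa [hy]) hab' hθ h
  have ha := left_mem_Icc.2 hab.le
  have hb := right_mem_Icc.2 hab.le
  rw [key a ha, key b hb] at hp
  have heq := (chart_inj (Ioo_subset_Ioc_self (hθ a ha)) (Ioo_subset_Ioc_self (hθ b hb)) hp).1
  obtain ⟨c, -, hc0⟩ := exists_hasDerivAt_eq_zero hab
    (fun t _ => (hϑ t).continuousAt.continuousWithinAt) heq (fun t _ => hϑ t)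
  have hs : speed 0 (ϑ c) = 0 := (mul_eq_zero.1 hc0).resolve_left (freq_pos j).ne'
  have := height_eq_const (freq j) le_rfl hϑ hs 0
  exact (speed_zero_pos h1 h2).ne' (by rw [this, hs])

theorem not_periodic_of_speed_eq_zero (hn : 2 ≤ n) {j : Fin (n + 1)}
    {γ : ℝ → EuclideanSpace ℂ (Fin (n + 1))} (hγ : ∀ t, HasDerivAt γ (field (γ t)) t) {θ : ℝ}
    (hθ : θ = 1 / 2 ∨ θ = -(1 / 2)) {y : Fin (n + 1) → ℂ} (hy : excess j y = 0) {t₀ T : ℝ}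
    (hT : 0 < T) (h : γ t₀ = chart j θ y) : γ (t₀ + T) ≠ γ t₀ := fun hp => by
  have hsp : speed 0 θ = 0 := by
    rcases hθ with rfl | rfl
    exacts [speed_zero_half, speed_zero_neg_half]
  have hsi : spin 0 θ ≠ 0 := by
    rcases hθ with rfl | rfl
    · rw [spin_zero_half]; norm_num
    · rw [spin_zero_neg_half]; norm_num
  have hm : θ ∈ Ioo (-Real.pi) Real.pi := by
    have := Real.pi_gt_three
    rcases hθ with rfl | rfl <;> constructor <;> linarith
  have key := eqOn_chart hn hγ (ϑ := fun _ => θ) (β := fun t => t * spin 0 θ)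
    (fun i hi => (norm_lt_one_of_excess_le hi (by simp [hy])).le) (by simp)
    (fun t => by simpa [hy, hsp] using hasDerivAt_const t θ)
    (fun t => by simpa [hy] using (hasDerivAt_id t).mul_const (spin 0 θ))
    (left_mem_Icc.2 hT.le) (fun _ _ => hm) h T (right_mem_Icc.2 hT.le)
  rw [hp, h] at key
  have hrot := (chart_inj (Ioo_subset_Ioc_self hm) (Ioo_subset_Ioc_self hm) key).2
  have hexp : ∀ i, i = j + 1 ∨ i = j + 2 → ∃ m : ℤ, rotFreq j i * (T * spin 0 θ) =
      m * (2 * Real.pi) := fun i hi => by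
    have hij : i ≠ j := by
      rcases hi with rfl | rfl
      exacts [add_one_ne hn j, add_two_ne hn j]
    have h1 := hrot i hij
    rw [rot, eq_sub_iff_add_eq, eq_comm, mul_eq_right₀ (norm_add_of_excess_eq_zero hij hi hy),
      Complex.exp_eq_one_iff] at h1
    obtain ⟨m, hm⟩ := h1
    refine ⟨m, ?_⟩
    rw [← mul_assoc, ← mul_assoc] at hm
    have := mul_right_cancel₀ Complex.I_ne_zero hm
    rw [mul_assoc] at this
    exact_mod_cast this
  obtain ⟨m, hm1⟩ := hexp (j + 1) (Or.inl rfl)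
  obtain ⟨m', hm2⟩ := hexp (j + 2) (Or.inr rfl)
  simp only [rotFreq, if_true, one_mul] at hm1
  rw [rotFreq, if_neg (add_two_ne_add_one hn j), if_pos rfl, hm1] at hm2
  have hm0 : m ≠ 0 := by
    rintro rfl
    rw [Int.cast_zero, zero_mul] at hm1
    exact (mul_ne_zero hT.ne' hsi) hm1
  have h5 : √2 * m = m' :=
    mul_right_cancel₀ (b := 2 * Real.pi) (by positivity) (by rw [← hm2]; ring)
  exact (irrational_sqrt_two.mul_intCast hm0).ne_int m' h5

theorem not_periodic_of_excess_eq_zero (hn : 2 ≤ n) {j : Fin (n + 1)}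
    {γ : ℝ → EuclideanSpace ℂ (Fin (n + 1))} (hγ : ∀ t, HasDerivAt γ (field (γ t)) t) {θ : ℝ}
    (hθ : θ ∈ Ioo (-Real.pi) Real.pi) {y : Fin (n + 1) → ℂ} (hy : excess j y = 0) {t₀ T : ℝ}
    (hT : 0 < T) (h : γ t₀ = chart j θ y) : ¬ ∀ t, γ (t + T) = γ t := fun hp => by
  by_cases h1 : θ = 1 / 2 ∨ θ = -(1 / 2)
  · exact not_periodic_of_speed_eq_zero hn hγ h1 hy hT h (hp t₀)
  push Not at h1
  obtain ⟨ϑ, rfl, hϑ⟩ := exists_height (freq j) le_rfl θ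
  have hmono : Monotone ϑ := monotone_of_deriv_nonneg (fun t => (hϑ t).differentiableAt)
    fun t => by rw [(hϑ t).deriv]; exact mul_nonneg (freq_pos j).le (speed_nonneg le_rfl _)
  have hcont : Continuous ϑ := continuous_iff_continuousAt.2 fun t => (hϑ t).continuousAt
  have hne : ∀ t, ϑ t ≠ 1 / 2 := fun t ht => h1.1 <| by
    rw [height_eq_const (freq j) le_rfl hϑ (t := t) (by rw [ht, speed_zero_half]) 0, ht]
  have hpi := Real.pi_gt_three
  rcases lt_or_gt_of_ne h1.1 with hlt | hgt
  · have hb : ∀ t, ϑ t < 1 / 2 := fun t => by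
      by_contra! hle
      obtain ⟨s, hs⟩ := mem_range_of_exists_le_of_exists_ge hcont ⟨0, hlt.le⟩ ⟨t, hle⟩
      exact hne s hs
    refine not_periodic_of_height hn hγ hy hϑ h1.1 h1.2 hT (Or.inl rfl) (fun t ht =>
      ⟨hθ.1.trans_le (hmono ht.1), (hb t).trans (by linarith)⟩) h ?_
    rw [add_zero, hp]
  · have hb : ∀ t, 1 / 2 < ϑ t := fun t => by
      by_contra! hle
      obtain ⟨s, hs⟩ := mem_range_of_exists_le_of_exists_ge hcont ⟨t, hle⟩ ⟨0, hgt.le⟩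
      exact hne s hs
    refine not_periodic_of_height hn hγ hy hϑ h1.1 h1.2 (neg_lt_zero.2 hT) (Or.inr rfl)
      (fun t ht => ⟨(by linarith : -Real.pi < 1 / 2).trans (hb t), (hmono ht.2).trans_lt hθ.2⟩) h ?_
    rw [add_zero, ← hp (t₀ + -T), neg_add_cancel_right]

/-! ### Straightening the field -/

/-- The angle by which a solution has been rotated when it reaches the height `θ` in the plug. -/
def angle (j : Fin (n + 1)) (s θ : ℝ) : ℝ :=
  (∫ u in (-1 : ℝ)..θ, spin s u / speed s u) / freq j

theorem continuous_spin_div_speed {s : ℝ} (hs : 0 < s) :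
    Continuous fun u => spin s u / speed s u :=
  (continuous_spin s).div (continuous_speed s) fun u => (speed_pos hs u).ne'

theorem hasDerivAt_angle (j : Fin (n + 1)) {s : ℝ} (hs : 0 < s) (θ : ℝ) :
    HasDerivAt (angle j s) (spin s θ / speed s θ / freq j) θ :=
  (((continuous_spin_div_speed hs).integral_hasStrictDerivAt (-1) θ).hasDerivAt).div_const _

theorem angle_eq_zero (j : Fin (n + 1)) {s θ : ℝ} (hs : 0 < s) (h : 1 / 16 ≤ s ∨ 1 ≤ |θ|) :
    angle j s θ = 0 := by
  have hi := fun a b => (continuous_spin_div_speed hs).intervalIntegrable (μ := volume) a b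
  have hout : ∀ u, 1 ≤ |u| → spin s u / speed s u = 0 := fun u hu => by
    rw [spin_of_one_le (one_le_level_of_one_le_abs hs.le hu), zero_div]
  rw [angle]
  refine div_eq_zero_iff.2 (Or.inl ?_)
  rcases h with h | h
  · simp [fun u => spin_of_one_le (one_le_level_of_le h u)]
  · rcases le_abs'.1 h with h | h
    · refine (intervalIntegral.integral_congr (g := fun _ => 0) fun u hu => hout u ?_).trans
        (by simp)
      rw [uIcc_of_ge h] at hu
      exact le_abs'.2 (Or.inl hu.2)
    · rw [← intervalIntegral.integral_add_adjacent_intervals (hi (-1) 1) (hi 1 θ)]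
      have h1 : ∫ u in (1 : ℝ)..θ, spin s u / speed s u = 0 := by
        refine (intervalIntegral.integral_congr (g := fun _ => 0) fun u hu => hout u ?_).trans
          (by simp)
        rw [uIcc_of_le h] at hu
        exact le_abs'.2 (Or.inr hu.1)
      have h2 := intervalIntegral.integral_comp_neg (a := -1) (b := 1)
        (fun u => spin s u / speed s u)
      simp only [spin_neg, speed_neg, neg_div, intervalIntegral.integral_neg, neg_neg] at h2
      rw [h1]; linarith

open Classical in
/-- The discontinuous map conjugating the modified field to a reparametrization of the base field,
away from the invariant tori of the plugs. -/
def straighten (z : EuclideanSpace ℂ (Fin (n + 1))) : EuclideanSpace ℂ (Fin (n + 1)) :=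
  if h : ∃ j, Active j z then
    chart h.choose (z h.choose).arg (rot h.choose
      (-angle h.choose (excess h.choose (slow h.choose z)) (z h.choose).arg) (slow h.choose z))
  else z

theorem straighten_of_active {j : Fin (n + 1)} {z : EuclideanSpace ℂ (Fin (n + 1))}
    (h : Active j z) : straighten z =
      chart j (z j).arg (rot j (-angle j (excess j (slow j z)) (z j).arg) (slow j z)) := by
  have h' : ∃ j, Active j z := ⟨j, h⟩
  have : h'.choose = j := h.eq h'.choose_spec
  rw [straighten, dif_pos h', this]

theorem straighten_of_not_active {z : EuclideanSpace ℂ (Fin (n + 1))}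
    (h : ∀ j, ¬ Active j z) : straighten z = z := dif_neg (not_exists.2 h)

theorem straighten_chart {j : Fin (n + 1)} {θ : ℝ} (hθ : θ ∈ Ioc (-Real.pi) Real.pi)
    {y : Fin (n + 1) → ℂ} (hy : ∀ i ≠ j, ‖y i‖ ≤ 1) (hs : excess j y ≠ 0) :
    straighten (chart j θ y) = chart j θ (rot j (-angle j (excess j y) θ) y) := by
  by_cases h : Active j (chart j θ y)
  · rw [straighten_of_active h, arg_chart hθ, excess_slow_chart hθ]
    exact chart_congr (fun i hi => by simp only [rot, slow_chart hθ y hi]) θ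
  · rw [straighten_of_not_active, angle_eq_zero j ((excess_nonneg j y).lt_of_ne' hs), neg_zero,
      rot_zero]
    · by_contra! h'
      exact h ⟨chart_apply_self_ne_zero j θ y, by rw [arg_chart hθ]; exact h'.2,
        by rw [excess_slow_chart hθ]; exact h'.1⟩
    · intro k
      by_cases hk : k = j
      · rwa [hk]
      · exact not_active_chart hk hy θ

theorem norm_lift_eq (j : Fin (n + 1)) (θ θ' : ℝ) (y : Fin (n + 1) → ℂ) :
    ‖lift j θ y‖ = ‖lift j θ' y‖ := by
  rw [EuclideanSpace.norm_eq, EuclideanSpace.norm_eq]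
  congr 1
  refine Finset.sum_congr rfl fun i _ => ?_
  by_cases hi : i = j
  · subst hi; rw [norm_lift_apply_self, norm_lift_apply_self]
  · rw [norm_lift_apply_of_ne hi, norm_lift_apply_of_ne hi]

theorem hasDerivAt_chart_apply (j i : Fin (n + 1)) (y : Fin (n + 1) → ℂ) {ϑ : ℝ → ℝ} {c t : ℝ}
    (h : HasDerivAt ϑ (freq j * c) t) :
    HasDerivAt (fun s => chart j (ϑ s) y i) (c * (I * freq i * chart j (ϑ t) y i)) t := by
  have h1 : ∀ θ, chart j θ y i = ((‖lift j 0 y‖⁻¹ : ℝ) : ℂ) * lift j θ y i := fun θ => by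
    rw [chart, norm_lift_eq j θ 0, PiLp.smul_apply, Complex.real_smul]
  simp only [h1, lift]
  refine (((hasDerivAt_cexp_ofReal (ratio j i) h).mul_const _).const_mul _).congr_deriv ?_
  rw [← ratio_mul j i]
  push_cast; ring

theorem inner_base_eq_zero {z w : EuclideanSpace ℂ (Fin (n + 1))}
    (h : ∀ i, w i = I * freq i * z i) : ⟪z, w⟫ = 0 := by
  rw [PiLp.inner_apply]
  refine Finset.sum_eq_zero fun i _ => ?_
  rw [h i, Complex.inner, mul_assoc]
  simp only [Complex.mul_re, Complex.mul_im, Complex.I_re, Complex.I_im,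
    Complex.conj_re, Complex.conj_im, Complex.ofReal_re, Complex.ofReal_im]
  ring

theorem total_pos {z : EuclideanSpace ℂ (Fin (n + 1))}
    (h : ∀ j, Active j z → excess j (slow j z) ≠ 0) : 0 < total z := by
  rcases total_pos_or z with h1 | ⟨j, hj, h1⟩
  · rw [h1]; exact one_pos
  · rw [h1]; exact speed_pos ((excess_nonneg _ _).lt_of_ne' (h j hj)) _

theorem exists_forall_norm_le (z : EuclideanSpace ℂ (Fin (n + 1))) :
    ∃ j, ∀ i, ‖z i‖ ≤ ‖z j‖ :=
  (Finite.exists_max fun i => ‖z i‖)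

theorem eventually_forall_not_active {j : Fin (n + 1)} {z : EuclideanSpace ℂ (Fin (n + 1))}
    (hz : z ≠ 0) (hj : ∀ i, ‖z i‖ ≤ ‖z j‖) (hs : z j ∉ Complex.slitPlane) :
    ∀ᶠ w in 𝓝 z, ∀ k, ¬ Active k w := by
  have hc : ∀ i, Continuous fun w : EuclideanSpace ℂ (Fin (n + 1)) => w i := fun i => by fun_prop
  have hj0 : 0 < ‖z j‖ := by
    by_contra! h
    exact hz (by ext i; simpa using (hj i).trans h)
  have h1 : ∀ k, ∀ᶠ w : EuclideanSpace ℂ (Fin (n + 1)) in 𝓝 z, 9 / 10 * ‖w k‖ < ‖w j‖ := fun k =>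
    (continuous_const.mul (hc k).norm).continuousAt.eventually_lt (hc j).norm.continuousAt
      (by simp only [Pi.mul_apply]; linarith [hj k])
  filter_upwards [eventually_not_active hz hs, eventually_all.2 h1] with w hw hw' k hk
  by_cases hkj : k = j
  · exact hw (hkj ▸ hk)
  · exact (hk.norm_lt_mul (Ne.symm hkj)).not_gt (hw' k)

theorem norm_slow_le {j : Fin (n + 1)} {z : EuclideanSpace ℂ (Fin (n + 1))}
    (hj : ∀ i, ‖z i‖ ≤ ‖z j‖) (i : Fin (n + 1)) : ‖slow j z i‖ ≤ 1 := by
  rw [norm_slow]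
  exact div_le_one_of_le₀ (hj i) (norm_nonneg _)

/-- Away from the invariant tori, the straightened solutions follow the base field. -/
theorem hasDerivAt_straighten (hn : 2 ≤ n) {γ : ℝ → EuclideanSpace ℂ (Fin (n + 1))}
    (h1 : ∀ t, ‖γ t‖ = 1) (hγ : ∀ t, HasDerivAt γ (field (γ t)) t)
    (hex : ∀ t j, γ t j ∈ Complex.slitPlane → excess j (slow j (γ t)) ≠ 0) (t : ℝ)
    (i : Fin (n + 1)) :
    HasDerivAt (fun s => straighten (γ s) i)
      (total (γ t) * (I * freq i * straighten (γ t) i)) t := by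
  obtain ⟨j, hj⟩ := exists_forall_norm_le (γ t)
  have h0 : γ t ≠ 0 := by rw [← norm_ne_zero_iff, h1]; exact one_ne_zero
  by_cases hs : γ t j ∈ Complex.slitPlane
  · have hy : ∀ i ≠ j, ‖slow j (γ t) i‖ ≤ 1 := fun i _ => norm_slow_le hj i
    have hpos : 0 < excess j (slow j (γ t)) := (excess_nonneg _ _).lt_of_ne' (hex t j hs)
    have hθ0 : (γ t j).arg ∈ Ioo (-Real.pi) Real.pi :=
      ⟨Complex.neg_pi_lt_arg _,
        (Complex.arg_le_pi _).lt_of_ne (Complex.mem_slitPlane_iff_arg.1 hs).1⟩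
    have hγt : chart j (γ t j).arg (slow j (γ t)) = γ t :=
      chart_arg_slow (h1 t) (Complex.slitPlane_ne_zero hs)
    generalize slow j (γ t) = y at *
    obtain ⟨ϑ, hϑ0, hϑ⟩ := exists_height (freq j) hpos.le (γ t j).arg
    rw [← hϑ0] at hθ0 hγt
    have hcont : Continuous ϑ := continuous_iff_continuousAt.2 fun t => (hϑ t).continuousAt
    obtain ⟨β, hβ0, hβ⟩ := exists_angle (excess j y) hcont
    obtain ⟨ε, hε, hball⟩ := Metric.eventually_nhds_iff.1
      (hcont.continuousAt.eventually_mem (Ioo_mem_nhds hθ0.1 hθ0.2))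
    have hIcc : ∀ t ∈ Icc (-(ε / 2)) (ε / 2), ϑ t ∈ Ioo (-Real.pi) Real.pi :=
        fun t ht => hball <| by
      rw [Real.dist_0_eq_abs]
      exact (abs_le.2 ht).trans_lt (by linarith)
    have key := eqOn_chart hn hγ hy hβ0 hϑ hβ (t₀ := t) (a := -(ε / 2)) (b := ε / 2)
      ⟨by linarith, by linarith⟩ hIcc hγt.symm
    set c := β 0 - angle j (excess j y) (ϑ 0) with hc
    have hconst : ∀ s, β s - angle j (excess j y) (ϑ s) = c := by
      have hd : ∀ s, HasDerivAt (fun s => β s - angle j (excess j y) (ϑ s)) 0 s := fun s => by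
        refine ((hβ s).sub ((hasDerivAt_angle j hpos (ϑ s)).comp s (hϑ s))).congr_deriv ?_
        have := (freq_pos j).ne'
        have := (speed_pos hpos (ϑ s)).ne'
        field_simp
        ring
      exact fun s => is_const_of_deriv_eq_zero (fun s => (hd s).differentiableAt)
        (fun s => (hd s).deriv) s 0
    have hst : ∀ s ∈ Icc (-(ε / 2)) (ε / 2),
        straighten (γ (t + s)) = chart j (ϑ s) (rot j c y) := fun s hs => by
      rw [key s hs, straighten_chart (Ioo_subset_Ioc_self (hIcc s hs)) (norm_rot_le hy hβ0 hβ s)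
        (by rw [excess_rot]; exact hpos.ne'), rot_rot, excess_rot, ← hconst s]
      ring_nf
    have htot : total (γ t) = speed (excess j y) (ϑ 0) := by
      rw [← hγt, total_chart (Ioo_subset_Ioc_self hθ0) hy]
    have h00 : (0 : ℝ) ∈ Icc (-(ε / 2)) (ε / 2) := ⟨by linarith, by linarith⟩
    have h3 := hasDerivAt_chart_apply j i (rot j c y) (hϑ 0)
    rw [← hst 0 h00, add_zero, ← htot] at h3
    have h4 : HasDerivAt (fun s => straighten (γ (t + s)) i)
        (total (γ t) * (I * freq i * straighten (γ t) i)) 0 :=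
      h3.congr_of_eventuallyEq <| by
        filter_upwards [Icc_mem_nhds (a := -(ε / 2)) (b := ε / 2) (by linarith) (by linarith)]
          with s hs
        rw [hst s hs]
    rw [← sub_self t] at h4
    simpa using h4.comp_sub_const t t
  · have hev := eventually_forall_not_active h0 hj hs
    have hevt := (hγ t).continuousAt.eventually hev
    have hna := hev.self_of_nhds
    have hraw := raw_of_forall_not_active hna
    rw [straighten_of_not_active hna, total_of_forall_not_active hna]
    refine HasDerivAt.congr_of_eventuallyEq ?_
      (hevt.mono fun s hs => congrArg (fun w => w i) (straighten_of_not_active hs))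
    have := hasDerivAt_piLp.1 (hγ t) i
    rw [field_of_norm_eq_one (h1 t), inner_base_eq_zero hraw, zero_smul, sub_zero, hraw i] at this
    simpa using this

/-! ### Absence of periodic orbits -/

theorem continuous_total {γ : ℝ → EuclideanSpace ℂ (Fin (n + 1))} (h1 : ∀ t, ‖γ t‖ = 1)
    (hγ : Continuous γ) : Continuous fun t => total (γ t) := by
  refine continuous_const.add (continuous_finsetSum _ fun j _ => ?_)
  refine continuous_iff_continuousAt.2 fun t => ?_
  have h0 : γ t ≠ 0 := by rw [← norm_ne_zero_iff, h1]; exact one_ne_zero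
  exact (contDiffAt_defect j h0).continuousAt.comp hγ.continuousAt

/-- The field has no periodic solution on the unit sphere, not even a constant one. -/
theorem not_periodic (hn : 2 ≤ n) {γ : ℝ → EuclideanSpace ℂ (Fin (n + 1))}
    (h1 : ∀ t, ‖γ t‖ = 1) (hγ : ∀ t, HasDerivAt γ (field (γ t)) t) {T : ℝ} (hT : 0 < T) :
    ¬ ∀ t, γ (t + T) = γ t := fun hp => by
  have hex : ∀ t j, γ t j ∈ Complex.slitPlane → excess j (slow j (γ t)) ≠ 0 := fun t j hs h =>
    not_periodic_of_excess_eq_zero hn hγ (θ := (γ t j).arg) (y := slow j (γ t)) (t₀ := t)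
      ⟨Complex.neg_pi_lt_arg _,
        (Complex.arg_le_pi _).lt_of_ne (Complex.mem_slitPlane_iff_arg.1 hs).1⟩ h hT
      (chart_arg_slow (h1 t) (Complex.slitPlane_ne_zero hs)).symm hp
  have hslit : ∀ {j : Fin (n + 1)} {z : EuclideanSpace ℂ (Fin (n + 1))}, Active j z →
      z j ∈ Complex.slitPlane := fun h => Complex.mem_slitPlane_iff_arg.2 ⟨fun h' => by
        have := h.2.1
        rw [h', abs_of_pos Real.pi_pos] at this
        linarith [Real.pi_gt_three], h.1⟩
  have hpos : ∀ t, 0 < total (γ t) := fun t => total_pos fun j hj => hex t j (hslit hj)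
  have hd := hasDerivAt_straighten hn h1 hγ hex
  have hcont := continuous_total h1 (continuous_iff_continuousAt.2 fun t => (hγ t).continuousAt)
  obtain ⟨τ, hτ0, hτ⟩ : ∃ τ : ℝ → ℝ, τ 0 = 0 ∧ ∀ t, HasDerivAt τ (total (γ t)) t :=
    ⟨fun t => ∫ u in (0 : ℝ)..t, total (γ u), by simp,
      fun t => (hcont.integral_hasStrictDerivAt 0 t).hasDerivAt⟩
  have hτpos : 0 < τ T := by
    rw [← hτ0]
    exact strictMono_of_deriv_pos (fun t => by rw [(hτ t).deriv]; exact hpos t) hT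
  have hsol : ∀ t i, straighten (γ t) i = Complex.exp (freq i * τ t * I) * straighten (γ 0) i := by
    intro t i
    have hg : ∀ s, HasDerivAt (fun s => Complex.exp ((-freq i : ℝ) * τ s * I) * straighten (γ s) i)
        0 s := fun s => by
      refine ((hasDerivAt_cexp_ofReal (-freq i) (hτ s)).mul (hd s i)).congr_deriv ?_
      push_cast; ring
    have := is_const_of_deriv_eq_zero (fun s => (hg s).differentiableAt) (fun s => (hg s).deriv) t 0
    simp only [hτ0, Complex.ofReal_zero, mul_zero, zero_mul, Complex.exp_zero, one_mul] at this
    rw [← this, ← mul_assoc, ← Complex.exp_add]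
    simp
  have hret : ∀ i, straighten (γ 0) i ≠ 0 → ∃ m : ℤ, freq i * τ T = m * (2 * Real.pi) := by
    intro i hi
    have h2 := hsol T i
    rw [← zero_add T, hp 0, zero_add, eq_comm, mul_eq_right₀ hi, Complex.exp_eq_one_iff] at h2
    obtain ⟨m, hm⟩ := h2
    rw [← mul_assoc] at hm
    exact ⟨m, by exact_mod_cast mul_right_cancel₀ Complex.I_ne_zero hm⟩
  have hnorm : ‖straighten (γ 0)‖ = 1 := by
    by_cases h : ∃ j, Active j (γ 0)
    · obtain ⟨j, hj⟩ := h
      rw [straighten_of_active hj, norm_chart]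
    · rw [straighten_of_not_active (not_exists.1 h), h1]
  obtain ⟨j, hj⟩ : ∃ j, straighten (γ 0) j ≠ 0 := by
    by_contra! h
    have : straighten (γ 0) = 0 := by ext i; simpa using h i
    simp [this] at hnorm
  obtain ⟨m, hm⟩ := hret j hj
  have hm0 : (0 : ℝ) < m := by
    have : 0 < m * (2 * Real.pi) := by rw [← hm]; exact mul_pos (freq_pos j) hτpos
    exact pos_of_mul_pos_left this (by positivity)
  have hzero : ∀ i ≠ j, straighten (γ 0) i = 0 := fun i hi => by
    by_contra h
    obtain ⟨m', hm'⟩ := hret i h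
    refine hi (eq_of_freq_mul_eq (m := m') (m' := m) ?_ ?_)
    · rintro rfl
      rw [Int.cast_zero, zero_mul] at hm'
      exact (mul_pos (freq_pos i) hτpos).ne' hm'
    · have h3 : freq i * m * (2 * Real.pi) = freq j * m' * (2 * Real.pi) := by
        rw [mul_assoc, ← hm, mul_assoc, ← hm']; ring
      exact mul_right_cancel₀ (by positivity) h3
  -- The straightened orbit passes through the point of the closed orbit `j` at height `0`.
  obtain ⟨t, ht⟩ : ∃ t, Complex.exp ((freq j * τ t : ℝ) * I) * straighten (γ 0) j = 1 := by
    have hone : ‖straighten (γ 0) j‖ = 1 := by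
      rw [EuclideanSpace.norm_eq, Finset.sum_eq_single j (fun i _ hi => by simp [hzero i hi])
        (by simp), Real.sqrt_sq (norm_nonneg _)] at hnorm
      exact hnorm
    have hc : Continuous fun t => freq j * τ t :=
      continuous_const.mul (continuous_iff_continuousAt.2 fun t => (hτ t).continuousAt)
    have hm1 : (1 : ℝ) ≤ m := by exact_mod_cast hm0
    obtain ⟨r, hr0, hr1, hr⟩ : ∃ r : ℝ, 0 ≤ r ∧ r ≤ 2 * Real.pi ∧
        Complex.exp (r * I) = Complex.exp (-(straighten (γ 0) j).arg * I) := by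
      have h3 := Complex.neg_pi_lt_arg (straighten (γ 0) j)
      have h4 := Complex.arg_le_pi (straighten (γ 0) j)
      rcases le_total (straighten (γ 0) j).arg 0 with h | h
      · exact ⟨-(straighten (γ 0) j).arg, by linarith, by linarith, by push_cast; rfl⟩
      · refine ⟨2 * Real.pi - (straighten (γ 0) j).arg, by linarith, by linarith, ?_⟩
        push_cast
        rw [sub_mul, sub_eq_add_neg, Complex.exp_add, Complex.exp_two_pi_mul_I, one_mul, neg_mul]
    obtain ⟨t, ht⟩ := mem_range_of_exists_le_of_exists_ge (c := r) hc
      ⟨0, by simpa [hτ0] using hr0⟩ ⟨T, by rw [hm]; nlinarith [Real.pi_pos]⟩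
    refine ⟨t, ?_⟩
    simp only at ht
    have hw := Complex.norm_mul_exp_arg_mul_I (straighten (γ 0) j)
    rw [hone, Complex.ofReal_one, one_mul] at hw
    rw [ht, hr]
    nth_rw 2 [← hw]
    rw [← Complex.exp_add, neg_mul, neg_add_cancel, Complex.exp_zero]
  have hwj : straighten (γ t) j = 1 := by rw [hsol, ← ht]; push_cast; rfl
  have hwi : ∀ i ≠ j, straighten (γ t) i = 0 := fun i hi => by rw [hsol, hzero i hi, mul_zero]
  have hw : excess j (slow j (straighten (γ t))) = 0 := by
    rw [← excess_zero j]
    exact excess_congr fun i hi => by simp [slow, hwi i hi]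
  by_cases h : ∃ k, Active k (γ t)
  · obtain ⟨k, hk⟩ := h
    have hkj : k = j := by
      by_contra hkj
      have := hwi k hkj
      rw [straighten_of_active hk] at this
      exact chart_apply_self_ne_zero _ _ _ this
    subst hkj
    rw [straighten_of_active hk, excess_slow_chart
      ⟨Complex.neg_pi_lt_arg _, Complex.arg_le_pi _⟩, excess_rot] at hw
    exact hex t k (hslit hk) hw
  · have h' := straighten_of_not_active (not_exists.1 h)
    rw [h'] at hwj hw
    exact h ⟨j, by simp [hwj], by simp [hwj], by rw [hw]; norm_num⟩

/-! ### Integrability of the density -/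

theorem integrableOn_abs_rpow (R : ℝ) :
    IntegrableOn (fun r : ℝ => |r| ^ (-(2 / 3) : ℝ)) (Metric.ball 0 R) := by
  rcases le_or_gt R 0 with h | h
  · simp [Metric.ball_eq_empty.2 h]
  · refine (integrableOn_fun_norm_addHaar (E := ℝ) volume
      (f := fun r : ℝ => r ^ (-(2 / 3) : ℝ))).2 ?_
    simpa using (intervalIntegral.integrableOn_Ioo_rpow_iff (s := -(2 / 3)) h).2 (by norm_num)

theorem integrableOn_abs_sub_rpow (a R : ℝ) :
    IntegrableOn (fun r : ℝ => |r - a| ^ (-(2 / 3) : ℝ)) (Metric.ball 0 R) := by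
  have h := (measurePreserving_sub_right volume a).integrableOn_comp_preimage
    (MeasurableEquiv.subRight a).measurableEmbedding
    (f := fun r : ℝ => |r| ^ (-(2 / 3) : ℝ)) (s := Metric.ball 0 (R + |a|))
  refine (h.2 (integrableOn_abs_rpow _)).mono_set fun r hr => ?_
  simp only [mem_preimage, mem_ball_zero_iff, Real.norm_eq_abs] at hr ⊢
  exact (abs_sub r a).trans_lt (by linarith)

theorem integrableOn_abs_sq_sub_sq_rpow {a : ℝ} (ha : 0 < a) (R : ℝ) :
    IntegrableOn (fun r : ℝ => |r ^ 2 - a ^ 2| ^ (-(2 / 3) : ℝ)) (Metric.ball 0 R) := by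
  have h := ((integrableOn_abs_sub_rpow a R).add (integrableOn_abs_sub_rpow (-a) R)).const_mul
    (a ^ (-(2 / 3) : ℝ))
  refine h.mono' (Measurable.aestronglyMeasurable (by fun_prop)) (Eventually.of_forall fun r => ?_)
  have h1 : ∀ x : ℝ, 0 ≤ |x| ^ (-(2 / 3) : ℝ) := fun x => by positivity
  have h2 : ∀ x : ℝ, a ≤ |x| → |x| ^ (-(2 / 3) : ℝ) ≤ a ^ (-(2 / 3) : ℝ) := fun x hx =>
    Real.rpow_le_rpow_of_nonpos ha hx (by norm_num)
  have h3 : r ^ 2 - a ^ 2 = (r - a) * (r - -a) := by ring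
  have h4 : 0 ≤ a ^ (-(2 / 3) : ℝ) := by positivity
  rw [Real.norm_of_nonneg (h1 _), h3, abs_mul, Real.mul_rpow (abs_nonneg _) (abs_nonneg _)]
  rcases le_total r 0 with hr | hr
  · have := h2 (r - a) (by rw [abs_of_nonpos (by linarith)]; linarith)
    have := mul_le_mul_of_nonneg_right this (h1 (r - -a))
    simp only [Pi.add_apply]
    nlinarith [mul_nonneg h4 (h1 (r - a))]
  · have := h2 (r - -a) (by rw [abs_of_nonneg (by linarith)]; linarith)
    have := mul_le_mul_of_nonneg_left this (h1 (r - a))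
    simp only [Pi.add_apply]
    nlinarith [mul_nonneg h4 (h1 (r - -a))]

theorem integrableOn_abs_normSq_rpow :
    IntegrableOn (fun u : ℂ => |normSq (u + 1 / 4) - 1 / 16| ^ (-(2 / 3) : ℝ))
      (Metric.ball 0 1) := by
  have h1 : IntegrableOn (fun u : ℂ => |‖u‖ ^ 2 - (1 / 4) ^ 2| ^ (-(2 / 3) : ℝ))
      (Metric.ball 0 2) := by
    refine (integrableOn_fun_norm_addHaar (E := ℂ) volume
      (f := fun r : ℝ => |r ^ 2 - (1 / 4) ^ 2| ^ (-(2 / 3) : ℝ))).2 ?_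
    rw [Complex.finrank_real_complex]
    have h := (integrableOn_abs_sq_sub_sq_rpow (a := 1 / 4) (by norm_num) 2).mono_set
      (s := Ioo 0 2) fun r hr => by
        rw [mem_ball_zero_iff, Real.norm_of_nonneg hr.1.le]; exact hr.2
    refine h.norm.const_mul 2 |>.mono' (by fun_prop) ?_
    filter_upwards [ae_restrict_mem measurableSet_Ioo] with r hr
    rw [norm_smul]
    gcongr
    simpa [abs_of_pos hr.1] using hr.2.le
  have h2 := (measurePreserving_add_right volume (1 / 4 : ℂ)).integrableOn_comp_preimage
    (MeasurableEquiv.addRight (1 / 4 : ℂ)).measurableEmbedding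
    (f := fun u : ℂ => |‖u‖ ^ 2 - (1 / 4) ^ 2| ^ (-(2 / 3) : ℝ)) (s := Metric.ball 0 2)
  have h3 := (h2.2 h1).mono_set (s := Metric.ball 0 1) fun u hu => by
    simp only [mem_preimage, mem_ball_zero_iff] at hu ⊢
    exact (norm_add_le _ _).trans_lt (by norm_num; linarith)
  refine h3.congr_fun (fun u _ => ?_) measurableSet_ball
  simp only [Function.comp_apply, Complex.normSq_eq_norm_sq]
  norm_num

theorem inv_add_add_le {a b c : ℝ} (ha : a ≠ 0) (hb : b ≠ 0) (hc : c ≠ 0) :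
    (a ^ 2 + b ^ 2 + c ^ 2)⁻¹ ≤
      |a| ^ (-(2 / 3) : ℝ) * (|b| ^ (-(2 / 3) : ℝ) * |c| ^ (-(2 / 3) : ℝ)) := by
  have h := Real.geom_mean_le_arith_mean3_weighted (w₁ := 1 / 3) (w₂ := 1 / 3) (w₃ := 1 / 3)
    (p₁ := a ^ 2) (p₂ := b ^ 2) (p₃ := c ^ 2) (by norm_num) (by norm_num) (by norm_num)
    (sq_nonneg a) (sq_nonneg b) (sq_nonneg c) (by norm_num)
  have e : ∀ x : ℝ, (x ^ 2) ^ (1 / 3 : ℝ) = |x| ^ (2 / 3 : ℝ) := fun x => by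
    rw [← sq_abs, ← Real.rpow_natCast, ← Real.rpow_mul (abs_nonneg _)]; norm_num
  simp only [e] at h
  simp only [Real.rpow_neg (abs_nonneg _), ← mul_inv]
  have := abs_pos.2 ha
  have := abs_pos.2 hb
  have := abs_pos.2 hc
  refine inv_anti₀ (by positivity) ?_
  rw [← mul_assoc]
  nlinarith [sq_nonneg a, sq_nonneg b, sq_nonneg c]

theorem add_le_excess (hn : 2 ≤ n) (j : Fin (n + 1)) (y : Fin (n + 1) → ℂ) :
    (normSq (y (j + 1) + 1 / 4) - 1 / 16) ^ 2 + (normSq (y (j + 2) + 1 / 4) - 1 / 16) ^ 2 ≤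
      excess j y := by
  have h := Finset.sum_le_sum_of_subset_of_nonneg (s := {j + 1, j + 2}) (t := Finset.univ.erase j)
    (f := fun i => if i = j + 1 ∨ i = j + 2 then (normSq (y i + 1 / 4) - 1 / 16) ^ 2
      else normSq (y i))
    (by simp [Finset.insert_subset_iff, add_one_ne hn, add_two_ne hn])
    fun i _ _ => excess_term_nonneg j i y
  rw [Finset.sum_pair (add_two_ne_add_one hn j).symm] at h
  simpa [excess] using h

/-- The domain of the flow boxes. -/
def box (n : ℕ) : Set (ℝ × (Fin (n + 1) → ℂ)) :=
  Ioo (-Real.pi) Real.pi ×ˢ Metric.ball 0 1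

/-- The density of the invariant measure in the flow box `j`. -/
def density (j : Fin (n + 1)) (ω : ℝ × (Fin (n + 1) → ℂ)) : ℝ := (speed (excess j ω.2) ω.1)⁻¹

theorem measurableSet_box : MeasurableSet (box n) := measurableSet_Ioo.prod measurableSet_ball

theorem measurable_density (j : Fin (n + 1)) : Measurable (density j) :=
  (contDiff_speed.continuous.comp
    (((continuous_excess j).comp continuous_snd).prodMk continuous_fst)).measurable.inv

theorem density_nonneg (j : Fin (n + 1)) (ω : ℝ × (Fin (n + 1) → ℂ)) : 0 ≤ density j ω :=
  inv_nonneg.2 (speed_nonneg (excess_nonneg j _) _)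

theorem ae_sq_sub_ne : ∀ᵐ θ : ℝ, θ ^ 2 - 1 / 4 ≠ 0 := by
  refine measure_mono_null (t := {1 / 2, -(1 / 2)}) (fun θ hθ => ?_) ((toFinite _).measure_zero _)
  simp only [mem_compl_iff, mem_ofPred_eq, not_not] at hθ
  simp only [mem_insert_iff, mem_singleton_iff]
  grind

theorem ae_normSq_sub_ne : ∀ᵐ u : ℂ, normSq (u + 1 / 4) - 1 / 16 ≠ 0 := by
  refine measure_mono_null (fun u hu => ?_)
    (Measure.addHaar_sphere (volume : Measure ℂ) (-(1 / 4)) (1 / 4))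
  simp only [mem_compl_iff, mem_ofPred_eq, not_not, Complex.normSq_eq_norm_sq] at hu
  rw [mem_sphere_iff_norm, sub_neg_eq_add]
  nlinarith [norm_nonneg (u + 1 / 4)]

theorem ae_ne (j : Fin (n + 1)) : ∀ᵐ ω : ℝ × (Fin (n + 1) → ℂ), ω.1 ^ 2 - 1 / 4 ≠ 0 ∧
    normSq (ω.2 (j + 1) + 1 / 4) - 1 / 16 ≠ 0 ∧ normSq (ω.2 (j + 2) + 1 / 4) - 1 / 16 ≠ 0 := by
  have h : ∀ i, ∀ᵐ ω : ℝ × (Fin (n + 1) → ℂ), normSq (ω.2 i + 1 / 4) - 1 / 16 ≠ 0 := fun i =>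
    ((Measure.quasiMeasurePreserving_eval (fun _ : Fin (n + 1) => (volume : Measure ℂ)) i).comp
      (Measure.quasiMeasurePreserving_snd (μ := (volume : Measure ℝ)))).ae ae_normSq_sub_ne
  filter_upwards [Measure.quasiMeasurePreserving_fst.ae ae_sq_sub_ne, h (j + 1), h (j + 2)]
    with ω h1 h2 h3 using ⟨h1, h2, h3⟩

theorem ae_speed_pos (j : Fin (n + 1)) :
    ∀ᵐ ω : ℝ × (Fin (n + 1) → ℂ), 0 < speed (excess j ω.2) ω.1 := by
  filter_upwards [ae_ne j] with ω hω
  refine ramp_pos ?_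
  have := excess_nonneg j ω.2
  have := hω.1
  unfold level
  positivity

theorem density_le (hn : 2 ≤ n) (j : Fin (n + 1)) {ω : ℝ × (Fin (n + 1) → ℂ)}
    (h1 : ω.1 ^ 2 - 1 / 4 ≠ 0) (h2 : normSq (ω.2 (j + 1) + 1 / 4) - 1 / 16 ≠ 0)
    (h3 : normSq (ω.2 (j + 2) + 1 / 4) - 1 / 16 ≠ 0) :
    density j ω ≤ 1 + |ω.1 ^ 2 - 1 / 4| ^ (-(2 / 3) : ℝ) *
      (|normSq (ω.2 (j + 1) + 1 / 4) - 1 / 16| ^ (-(2 / 3) : ℝ) *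
        |normSq (ω.2 (j + 2) + 1 / 4) - 1 / 16| ^ (-(2 / 3) : ℝ)) := by
  refine le_trans ?_ (add_le_add le_rfl (inv_add_add_le h1 h2 h3))
  have hx := add_le_excess hn j ω.2
  have hpos : 0 < (ω.1 ^ 2 - 1 / 4) ^ 2 + (normSq (ω.2 (j + 1) + 1 / 4) - 1 / 16) ^ 2 +
      (normSq (ω.2 (j + 2) + 1 / 4) - 1 / 16) ^ 2 := by positivity
  have hle : (ω.1 ^ 2 - 1 / 4) ^ 2 + (normSq (ω.2 (j + 1) + 1 / 4) - 1 / 16) ^ 2 +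
      (normSq (ω.2 (j + 2) + 1 / 4) - 1 / 16) ^ 2 ≤ level (excess j ω.2) ω.1 := by
    have := excess_nonneg j ω.2
    unfold level
    nlinarith [sq_nonneg (ω.1 ^ 2 - 1 / 4)]
  rcases le_total 1 (level (excess j ω.2) ω.1) with h | h
  · rw [density, speed_of_one_le h, inv_one]
    exact le_add_of_nonneg_right (inv_nonneg.2 hpos.le)
  · exact (inv_anti₀ hpos (hle.trans (le_ramp h))).trans (le_add_of_nonneg_left zero_le_one)

theorem integrableOn_density (hn : 2 ≤ n) (j : Fin (n + 1)) :
    IntegrableOn (density j) (box n) := by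
  let B : ℂ → ℝ := fun u => |normSq (u + 1 / 4) - 1 / 16| ^ (-(2 / 3) : ℝ)
  have hvol : (volume : Measure (Fin (n + 1) → ℂ)).restrict (Metric.ball 0 1) =
      Measure.pi fun _ => (volume : Measure ℂ).restrict (Metric.ball 0 1) := by
    rw [ball_pi _ one_pos, volume_pi, Measure.restrict_pi_pi]; rfl
  have hy : IntegrableOn (fun y : Fin (n + 1) → ℂ => B (y (j + 1)) * B (y (j + 2)))
      (Metric.ball 0 1) := by
    have h := Integrable.fintype_prod (μ := fun _ : Fin (n + 1) =>
        (volume : Measure ℂ).restrict (Metric.ball 0 1))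
      (f := fun i u => if i = j + 1 ∨ i = j + 2 then B u else 1) fun i => by
        split_ifs
        · exact integrableOn_abs_normSq_rpow
        · exact integrableOn_const measure_ball_lt_top.ne
    rw [← hvol] at h
    refine h.congr (Eventually.of_forall fun y => ?_)
    have hne := (add_two_ne_add_one hn j).symm
    have h2 := Finset.prod_subset (Finset.subset_univ {j + 1, j + 2})
      (f := fun i => if i = j + 1 ∨ i = j + 2 then B (y i) else 1)
      fun i _ hi => if_neg (by simpa using hi)
    rw [Finset.prod_pair hne] at h2
    simpa using h2.symm
  have hθ : IntegrableOn (fun θ : ℝ => |θ ^ 2 - 1 / 4| ^ (-(2 / 3) : ℝ))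
      (Ioo (-Real.pi) Real.pi) := by
    have := integrableOn_abs_sq_sub_sq_rpow (a := 1 / 2) (by norm_num) Real.pi
    rw [Real.ball_eq_Ioo] at this
    norm_num at this ⊢
    exact this
  have hbox : (volume : Measure (ℝ × (Fin (n + 1) → ℂ))).restrict (box n) =
      (volume.restrict (Ioo (-Real.pi) Real.pi)).prod (volume.restrict (Metric.ball 0 1)) := by
    rw [box, Measure.volume_eq_prod, Measure.prod_restrict]
  have h : IntegrableOn (fun ω : ℝ × (Fin (n + 1) → ℂ) => 1 + |ω.1 ^ 2 - 1 / 4| ^ (-(2 / 3) : ℝ) *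
      (B (ω.2 (j + 1)) * B (ω.2 (j + 2)))) (box n) := by
    rw [IntegrableOn, hbox]
    have : IsFiniteMeasure ((volume : Measure (Fin (n + 1) → ℂ)).restrict (Metric.ball 0 1)) :=
      ⟨by simpa using measure_ball_lt_top⟩
    exact (integrable_const _).add (hθ.mul_prod hy)
  refine h.mono' (measurable_density j).aestronglyMeasurable (ae_restrict_of_ae ?_)
  filter_upwards [ae_ne j] with ω hω
  rw [Real.norm_of_nonneg (density_nonneg j ω)]
  exact density_le hn j hω.1 hω.2.1 hω.2.2

/-! ### Regularity and symmetries of the flow boxes -/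

theorem contDiff_lift (j : Fin (n + 1)) :
    ContDiff ℝ 1 fun ω : ℝ × (Fin (n + 1) → ℂ) => lift j ω.1 ω.2 := by
  refine contDiff_piLp' 2 fun i => ?_
  simp only [lift]
  have h1 : ContDiff ℝ 1 fun ω : ℝ × (Fin (n + 1) → ℂ) => (ω.1 : ℂ) :=
    Complex.ofRealCLM.contDiff.comp contDiff_fst
  have h2 : ContDiff ℝ 1 fun ω : ℝ × (Fin (n + 1) → ℂ) => if i = j then (1 : ℂ) else ω.2 i := by
    split_ifs <;> fun_prop
  exact (((contDiff_const.mul h1).mul contDiff_const).cexp).mul h2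

theorem contDiff_chart (j : Fin (n + 1)) :
    ContDiff ℝ 1 fun ω : ℝ × (Fin (n + 1) → ℂ) => chart j ω.1 ω.2 :=
  (((contDiff_lift j).norm ℝ fun ω => lift_ne_zero j ω.1 ω.2).inv
    fun ω => norm_ne_zero_iff.2 (lift_ne_zero j ω.1 ω.2)).smul (contDiff_lift j)

theorem chart_add_two_pi (j : Fin (n + 1)) (θ : ℝ) (y : Fin (n + 1) → ℂ) :
    chart j (θ + 2 * Real.pi) y =
      chart j θ fun i => Complex.exp (ratio j i * (2 * Real.pi : ℝ) * I) * y i := by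
  have : lift j (θ + 2 * Real.pi) y =
      lift j θ fun i => Complex.exp (ratio j i * (2 * Real.pi : ℝ) * I) * y i := by
    ext i
    by_cases hi : i = j
    · subst hi
      simp only [lift_apply_self]
      push_cast
      rw [add_mul, Complex.exp_add, Complex.exp_two_pi_mul_I, mul_one]
    · simp only [lift, if_neg hi]
      rw [← mul_assoc, ← Complex.exp_add]
      push_cast
      ring_nf
  rw [chart, chart, this]

theorem measurePreserving_exp_mul (a : ℝ) :
    MeasurePreserving (fun u : ℂ => Complex.exp (a * I) * u) :=
  (rotation (Circle.exp a)).measurePreserving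

theorem measurePreserving_pi_exp_mul (a : Fin (n + 1) → ℝ) :
    MeasurePreserving (fun (y : Fin (n + 1) → ℂ) i => Complex.exp (a i * I) * y i) :=
  volume_preserving_pi fun i => measurePreserving_exp_mul (a i)

theorem measurePreserving_rot (j : Fin (n + 1)) (b : ℝ) : MeasurePreserving (rot j b) := by
  refine volume_preserving_pi
    (f := fun i u => Complex.exp (rotFreq j i * b * I) * (u + 1 / 4) - 1 / 4)
    fun i => ?_
  have h := measurePreserving_exp_mul (rotFreq j i * b)
  push_cast at h
  exact (measurePreserving_sub_right volume _).comp
    (h.comp (measurePreserving_add_right volume _))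

theorem continuous_rot (j : Fin (n + 1)) (b : ℝ) : Continuous (rot j b) := by
  unfold rot; fun_prop

theorem mem_box {ω : ℝ × (Fin (n + 1) → ℂ)} :
    ω ∈ box n ↔ ω.1 ∈ Ioo (-Real.pi) Real.pi ∧ ∀ i, ‖ω.2 i‖ < 1 := by
  rw [box, mem_prod, mem_ball_zero_iff, pi_norm_lt_iff one_pos]

theorem rot_self (hn : 2 ≤ n) (j : Fin (n + 1)) (b : ℝ) (y : Fin (n + 1) → ℂ) :
    rot j b y j = y j := by
  simp [rot, rotFreq_self hn]

theorem rot_mem_box_iff (hn : 2 ≤ n) {j : Fin (n + 1)} (b : ℝ) {ω : ℝ × (Fin (n + 1) → ℂ)}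
    (h : spin (excess j ω.2) ω.1 ≠ 0) : (ω.1, rot j b ω.2) ∈ box n ↔ ω ∈ box n := by
  have hx : excess j ω.2 ≤ 1 / 16 := by
    by_contra! hx
    exact h (spin_of_one_le (one_le_level_of_le hx.le _))
  simp only [mem_box]
  refine and_congr_right fun _ => forall_congr' fun i => ?_
  by_cases hi : i = j
  · rw [hi, rot_self hn]
  · exact iff_of_true (norm_lt_one_of_excess_le hi (by rwa [excess_rot]))
      (norm_lt_one_of_excess_le hi hx)

/-! ### Integrals over the flow boxes -/

section Integrals

variable {Ψ : EuclideanSpace ℂ (Fin (n + 1)) → ℝ} {B : ℝ}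

theorem integrableOn_density_mul (hn : 2 ≤ n) (j : Fin (n + 1)) {F : ℝ × (Fin (n + 1) → ℂ) → ℝ}
    (hF : Continuous F) (hB : ∀ ω, |F ω| ≤ B) :
    IntegrableOn (fun ω => density j ω * F ω) (box n) :=
  (integrableOn_density hn j).mul_bdd (c := B) hF.aestronglyMeasurable (Eventually.of_forall hB)

theorem integrableOn_spin_mul (hn : 2 ≤ n) (j : Fin (n + 1)) {F : ℝ × (Fin (n + 1) → ℂ) → ℝ}
    (hF : Continuous F) (hB : ∀ ω, |F ω| ≤ B) :
    IntegrableOn (fun ω => spin (excess j ω.2) ω.1 * (density j ω * F ω)) (box n) := by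
  have hs : Continuous fun ω : ℝ × (Fin (n + 1) → ℂ) => spin (excess j ω.2) ω.1 :=
    contDiff_spin.continuous.comp
      (((continuous_excess j).comp continuous_snd).prodMk continuous_fst)
  refine (integrableOn_density_mul hn j hF hB).bdd_mul (c := Real.pi) hs.aestronglyMeasurable ?_
  filter_upwards [ae_restrict_mem measurableSet_box] with ω hω
  exact (abs_spin_le _ _).trans (abs_le.2 ⟨(mem_box.1 hω).1.1.le, (mem_box.1 hω).1.2.le⟩)

theorem volume_box_ne_top : volume (box n) ≠ ⊤ := by
  rw [box, Measure.volume_eq_prod, Measure.prod_prod]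
  exact ENNReal.mul_ne_top (by simp) measure_ball_lt_top.ne

theorem integrableOn_box {F : ℝ × (Fin (n + 1) → ℂ) → ℝ}
    (hF : Continuous F) (hB : ∀ ω, |F ω| ≤ B) : IntegrableOn F (box n) :=
  Measure.integrableOn_of_bounded volume_box_ne_top hF.aestronglyMeasurable
    (Eventually.of_forall hB)

theorem setIntegral_box {F : ℝ × (Fin (n + 1) → ℂ) → ℝ} (hF : IntegrableOn F (box n)) :
    ∫ ω in box n, F ω =
      ∫ θ in (-Real.pi)..Real.pi, ∫ y in Metric.ball (0 : Fin (n + 1) → ℂ) 1, F (θ, y) := by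
  rw [intervalIntegral.integral_of_le (by linarith [Real.pi_pos]), integral_Ioc_eq_integral_Ioo]
  exact setIntegral_prod F hF

theorem setIntegral_box_add {F : ℝ × (Fin (n + 1) → ℂ) → ℝ} (hF : Continuous F)
    (hB : ∀ ω, |F ω| ≤ B)
    (hper : Function.Periodic
      (fun θ => ∫ y in Metric.ball (0 : Fin (n + 1) → ℂ) 1, F (θ, y)) (2 * Real.pi)) (c : ℝ) :
    ∫ ω in box n, F (ω.1 + c, ω.2) = ∫ ω in box n, F ω := by
  have hc : Continuous fun ω : ℝ × (Fin (n + 1) → ℂ) => (ω.1 + c, ω.2) := by fun_prop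
  have h1 := hper.intervalIntegral_add_eq (-Real.pi + c) (-Real.pi)
  rw [show -Real.pi + c + 2 * Real.pi = Real.pi + c by ring,
    show -Real.pi + 2 * Real.pi = Real.pi by ring] at h1
  rw [setIntegral_box (integrableOn_box hF hB), ← h1, setIntegral_box
    (F := fun ω => F (ω.1 + c, ω.2)) (integrableOn_box (hF.comp hc) fun ω => hB (ω.1 + c, ω.2))]
  exact intervalIntegral.integral_comp_add_right
    (fun θ => ∫ y in Metric.ball (0 : Fin (n + 1) → ℂ) 1, F (θ, y)) c

theorem continuous_comp_chart (j : Fin (n + 1)) (hΨ : Continuous Ψ) :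
    Continuous fun ω : ℝ × (Fin (n + 1) → ℂ) => Ψ (chart j ω.1 ω.2) :=
  hΨ.comp (contDiff_chart j).continuous

/-- The base flow preserves the measure in the flow box. -/
theorem integral_chart_add (j : Fin (n + 1)) (hΨ : Continuous Ψ) (hB : ∀ x, |Ψ x| ≤ B) (c : ℝ) :
    ∫ ω in box n, Ψ (chart j (ω.1 + c) ω.2) = ∫ ω in box n, Ψ (chart j ω.1 ω.2) := by
  refine setIntegral_box_add (continuous_comp_chart j hΨ) (fun ω => hB _) (fun θ => ?_) c
  have hm := measurePreserving_pi_exp_mul fun i => ratio j i * (2 * Real.pi)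
  have hpre : (fun (y : Fin (n + 1) → ℂ) i =>
      Complex.exp ((ratio j i * (2 * Real.pi) : ℝ) * I) * y i) ⁻¹' Metric.ball 0 1 =
      Metric.ball 0 1 := by
    ext y
    simp only [mem_preimage, mem_ball_zero_iff, pi_norm_lt_iff one_pos, norm_mul,
      Complex.norm_exp_ofReal_mul_I, one_mul]
  have hr := hm.restrict_preimage (s := Metric.ball 0 1) measurableSet_ball
  rw [hpre] at hr
  have hc : Continuous fun y => Ψ (chart j θ y) :=
    (continuous_comp_chart j hΨ).comp (f := fun y => (θ, y)) (by fun_prop)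
  beta_reduce
  conv_rhs => rw [← hr.map_eq]
  rw [integral_map hr.aemeasurable hc.aestronglyMeasurable]
  simp only [chart_add_two_pi, Complex.ofReal_mul]

/-- The rotations of the plug preserve the measure in the flow box. -/
theorem integral_chart_rot (hn : 2 ≤ n) (j : Fin (n + 1)) (hΨ : Continuous Ψ) (b : ℝ) :
    ∫ ω in box n, spin (excess j ω.2) ω.1 * (density j ω * Ψ (chart j ω.1 (rot j b ω.2))) =
      ∫ ω in box n, spin (excess j ω.2) ω.1 * (density j ω * Ψ (chart j ω.1 ω.2)) := by
  have hs : Continuous fun ω : ℝ × (Fin (n + 1) → ℂ) => spin (excess j ω.2) ω.1 :=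
    contDiff_spin.continuous.comp
      (((continuous_excess j).comp continuous_snd).prodMk continuous_fst)
  have hm : MeasurePreserving (Prod.map id (rot j b) : ℝ × (Fin (n + 1) → ℂ) → _) :=
    (MeasurePreserving.id volume).prod (measurePreserving_rot j b)
  have hmeas : Measurable ((box n).indicator fun ω : ℝ × (Fin (n + 1) → ℂ) =>
      spin (excess j ω.2) ω.1 * (density j ω * Ψ (chart j ω.1 ω.2))) :=
    (hs.measurable.mul ((measurable_density j).mul
      (continuous_comp_chart j hΨ).measurable)).indicator
      measurableSet_box
  rw [← integral_indicator measurableSet_box, ← integral_indicator measurableSet_box]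
  conv_rhs => rw [← hm.map_eq]
  rw [integral_map hm.aemeasurable hmeas.aestronglyMeasurable]
  refine integral_congr_ae (Eventually.of_forall fun ω => ?_)
  by_cases h : spin (excess j ω.2) ω.1 = 0
  · simp [indicator, h, excess_rot]
  · have hb : Prod.map id (rot j b) ω ∈ box n ↔ ω ∈ box n := rot_mem_box_iff hn b h
    by_cases hω : ω ∈ box n
    · simp [indicator, hω, hb.2 hω, excess_rot, density]
    · simp [indicator, hω, mt hb.1 hω]

end Integrals

/-! ### Infinitesimal invariance of the measure in a flow box -/

theorem abs_rotFreq_le (j i : Fin (n + 1)) : |rotFreq j i| ≤ 2 := by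
  have h : |√2| ≤ 2 := by
    rw [abs_of_nonneg (Real.sqrt_nonneg 2), Real.sqrt_le_left (by norm_num)]
    norm_num
  unfold rotFreq
  split_ifs
  · norm_num
  · exact h
  · norm_num

theorem norm_rot_sub_le (j : Fin (n + 1)) (b : ℝ) {y : Fin (n + 1) → ℂ} (hy : ‖y‖ ≤ 1) :
    ‖rot j b y - y‖ ≤ 4 * |b| := by
  refine (pi_norm_le_iff_of_nonneg (by positivity)).2 fun i => ?_
  have h1 : ‖Complex.exp (rotFreq j i * b * I) - 1‖ ≤ 2 * |b| := by
    have h := Real.norm_exp_I_mul_ofReal_sub_one_le (x := rotFreq j i * b)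
    rw [norm_mul, Real.norm_eq_abs, Real.norm_eq_abs, mul_comm I] at h
    push_cast at h
    exact h.trans (mul_le_mul_of_nonneg_right (abs_rotFreq_le j i) (abs_nonneg b))
  have h2 : ‖y i + 1 / 4‖ ≤ 2 := by
    have := norm_add_le (y i) (1 / 4)
    have := (norm_le_pi_norm y i).trans hy
    norm_num at *
    linarith
  calc ‖rot j b y i - y i‖ = ‖(Complex.exp (rotFreq j i * b * I) - 1) * (y i + 1 / 4)‖ := by
        congr 1; simp only [rot]; ring
    _ ≤ 2 * |b| * 2 := by rw [norm_mul]; gcongr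
    _ = 4 * |b| := by ring

theorem norm_le_of_mem_box {ω : ℝ × (Fin (n + 1) → ℂ)} (hω : ω ∈ box n) :
    ‖ω.1‖ ≤ 4 ∧ ‖ω.2‖ ≤ 1 := by
  rw [box, mem_prod, mem_ball_zero_iff] at hω
  exact ⟨(abs_le.2 ⟨hω.1.1.le, hω.1.2.le⟩).trans Real.pi_le_four, hω.2.le⟩

theorem exists_lipschitzOnWith_chart (j : Fin (n + 1)) (R : ℝ) :
    ∃ L, LipschitzOnWith L (fun ω : ℝ × (Fin (n + 1) → ℂ) => chart j ω.1 ω.2)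
      (Metric.closedBall 0 R) :=
  (contDiff_chart j).contDiffOn.exists_lipschitzOnWith one_ne_zero (convex_closedBall _ _)
    (isCompact_closedBall _ _)

/-- The displacement of the charts under the two flows composing the plug. -/
theorem exists_norm_chart_sub_le (j : Fin (n + 1)) :
    ∃ L : ℝ, 0 ≤ L ∧ ∀ ω ∈ box n, ∀ s ∈ Metric.closedBall (0 : ℝ) 1,
      ‖chart j (ω.1 + freq j * s) ω.2 - chart j ω.1 ω.2‖ ≤ L * |s| ∧
      ‖chart j ω.1 (rot j s ω.2) - chart j ω.1 ω.2‖ ≤ L * |s| := by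
  have hf := freq_pos j
  obtain ⟨L, hL⟩ := exists_lipschitzOnWith_chart j (5 + freq j)
  refine ⟨L * (4 + freq j), by positivity, fun ω hω s hs => ?_⟩
  obtain ⟨h1, h2⟩ := norm_le_of_mem_box hω
  rw [mem_closedBall_zero_iff, Real.norm_eq_abs] at hs
  have hmem : ∀ ω' : ℝ × (Fin (n + 1) → ℂ), ‖ω'.1‖ ≤ 5 + freq j → ‖ω'.2‖ ≤ 5 + freq j →
      ω' ∈ Metric.closedBall 0 (5 + freq j) := fun ω' h h' => by
    rw [mem_closedBall_zero_iff, Prod.norm_def]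
    exact max_le h h'
  have h0 := hmem ω (by linarith) (by linarith)
  have hr := norm_rot_sub_le j s h2
  have hfs : ‖freq j * s‖ ≤ freq j := by
    rw [norm_mul, Real.norm_of_nonneg hf.le]
    exact mul_le_of_le_one_right hf.le hs
  constructor
  · have h3 := hL.norm_sub_le (hmem (ω.1 + freq j * s, ω.2)
      ((norm_add_le _ _).trans (by linarith)) (by dsimp only; linarith)) h0
    refine h3.trans ?_
    rw [mul_assoc]
    refine mul_le_mul_of_nonneg_left ?_ L.2
    simp only [Prod.norm_def, Prod.fst_sub, Prod.snd_sub, add_sub_cancel_left, sub_self, norm_zero,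
      norm_mul, Real.norm_of_nonneg hf.le, Real.norm_eq_abs]
    exact max_le (by nlinarith [abs_nonneg s]) (by positivity)
  · have h3 := hL.norm_sub_le (hmem (ω.1, rot j s ω.2) (by dsimp only; linarith)
      (by
        have := norm_add_le (rot j s ω.2 - ω.2) ω.2
        rw [sub_add_cancel] at this
        dsimp only
        linarith)) h0
    refine h3.trans ?_
    rw [mul_assoc]
    refine mul_le_mul_of_nonneg_left ?_ L.2
    simp only [Prod.norm_def, Prod.fst_sub, Prod.snd_sub, sub_self, norm_zero]
    exact max_le (by positivity) (by nlinarith [abs_nonneg s])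

theorem isOpen_box : IsOpen (box n) := isOpen_Ioo.prod Metric.isOpen_ball

section

variable {Ψ : EuclideanSpace ℂ (Fin (n + 1)) → ℝ} {B : ℝ} {K : ℝ≥0}

theorem ae_differentiableAt_comp_chart (j : Fin (n + 1)) (hΨ : LipschitzWith K Ψ) :
    ∀ᵐ ω : ℝ × (Fin (n + 1) → ℂ), ω ∈ box n →
      DifferentiableAt ℝ (fun ω : ℝ × (Fin (n + 1) → ℂ) => Ψ (chart j ω.1 ω.2)) ω := by
  obtain ⟨L, hL⟩ := exists_lipschitzOnWith_chart j 5
  have hsub : box n ⊆ Metric.closedBall 0 5 := fun ω hω => by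
    obtain ⟨h1, h2⟩ := norm_le_of_mem_box hω
    rw [mem_closedBall_zero_iff, Prod.norm_def]
    exact max_le (by linarith) (by linarith)
  have : (volume : Measure (ℝ × (Fin (n + 1) → ℂ))).IsAddHaarMeasure := by
    rw [Measure.volume_eq_prod]; exact Measure.prod.instIsAddHaarMeasure _ _
  have h := (hΨ.comp_lipschitzOnWith (hL.mono hsub)).ae_differentiableWithinAt_of_mem
    (μ := volume)
  filter_upwards [h] with ω h hω
  exact (h hω).differentiableAt (isOpen_box.mem_nhds hω)

/-- A Lipschitz function has the same derivative along tangent curves. -/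
theorem _root_.LipschitzWith.hasDerivAt_comp_of_tangent {E : Type*} [NormedAddCommGroup E]
    [NormedSpace ℝ E] {f : E → ℝ} (hf : LipschitzWith K f) {p q : ℝ → E} {v : E} {d t : ℝ}
    (h0 : p t = q t) (hp : HasDerivAt p v t) (hq : HasDerivAt q v t)
    (hd : HasDerivAt (fun s => f (q s)) d t) : HasDerivAt (fun s => f (p s)) d t := by
  have h1 : (fun s => p s - q s) =o[𝓝 t] fun s => s - t := by
    have := hasDerivAt_iff_isLittleO.1 (hp.sub hq)
    simpa [h0] using this
  have h2 : (fun s => f (p s) - f (q s)) =o[𝓝 t] fun s => s - t :=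
    (Asymptotics.IsBigO.of_bound K (Eventually.of_forall fun s =>
      hf.norm_sub_le (p s) (q s))).trans_isLittleO h1
  have h3 := h2.add (hasDerivAt_iff_isLittleO.1 hd)
  refine hasDerivAt_iff_isLittleO.2 (h3.congr_left fun s => ?_)
  simp only [h0]; ring

theorem hasDerivAt_remainder (hn : 2 ≤ n) (j : Fin (n + 1)) (hΨ : LipschitzWith K Ψ)
    {ω : ℝ × (Fin (n + 1) → ℂ)} (hω : ω ∈ box n) (hpos : 0 < speed (excess j ω.2) ω.1)
    (hdiff : DifferentiableAt ℝ (fun ω : ℝ × (Fin (n + 1) → ℂ) => Ψ (chart j ω.1 ω.2)) ω)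
    {p : ℝ → EuclideanSpace ℂ (Fin (n + 1))} (h0 : p 0 = chart j ω.1 ω.2)
    (hp : HasDerivAt p (field (chart j ω.1 ω.2)) 0) :
    HasDerivAt (fun s => density j ω * Ψ (p s) - Ψ (chart j (ω.1 + freq j * s) ω.2) -
      spin (excess j ω.2) ω.1 * (density j ω * Ψ (chart j ω.1 (rot j s ω.2)))) 0 0 := by
  obtain ⟨θ, y⟩ := ω
  obtain ⟨hθ, hy⟩ := mem_box.1 hω
  set A := fderiv ℝ (fun ω : ℝ × (Fin (n + 1) → ℂ) => Ψ (chart j ω.1 ω.2)) (θ, y)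
  have hA := hdiff.hasFDerivAt
  set f := speed (excess j y) θ
  set g := spin (excess j y) θ
  set v : Fin (n + 1) → ℂ := fun i => rotFreq j i * I * (y i + 1 / 4)
  have hrot : ∀ c : ℝ, HasDerivAt (fun s => rot j (c * s) y) (c • v) 0 := fun c => by
    refine hasDerivAt_pi.2 fun i => ?_
    have := hasDerivAt_rot (j := j) ((hasDerivAt_id (0 : ℝ)).const_mul c) y i
    simp only [id, mul_one, mul_zero, rot_zero] at this
    refine this.congr_deriv ?_
    simp only [v, Pi.smul_apply, Complex.real_smul]
    ring
  have hlin : ∀ c : ℝ, HasDerivAt (fun s => θ + c * s) c 0 := fun c => by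
    simpa using ((hasDerivAt_id (0 : ℝ)).const_mul c).const_add θ
  have h1 : ∀ a b : ℝ, HasDerivAt (fun s => Ψ (chart j (θ + a * s) (rot j (b * s) y)))
      (A (a, b • v)) 0 := fun a b =>
    hA.comp_hasDerivAt_of_eq (f := fun s => (θ + a * s, rot j (b * s) y)) 0
      ((hlin a).prodMk (hrot b)) (by simp [rot_zero])
  have hd : HasDerivAt (fun s => chart j (θ + freq j * f * s) (rot j (g * s) y))
      (field (chart j θ y)) 0 := by
    have := hasDerivAt_chart (j := j) (y := y) (ϑ := fun s => θ + freq j * f * s)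
      (β := fun s => g * s) (t := 0) hn (by simpa using ⟨hθ.1, hθ.2.le⟩)
      (by simpa [rot_zero] using fun i _ => (hy i).le) (by simpa using hlin (freq j * f))
      (by simpa using (hasDerivAt_id (0 : ℝ)).const_mul g)
    simpa [rot_zero] using this
  have h2 := hΨ.hasDerivAt_comp_of_tangent (by simp [h0, rot_zero]) hp hd (h1 (freq j * f) g)
  have h3 := h1 (freq j) 0
  have h4 := h1 0 1
  simp only [zero_mul, rot_zero, add_zero, one_mul, zero_smul, one_smul] at h3 h4
  refine (((h2.const_mul (density j (θ, y))).sub h3).sub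
    ((h4.const_mul (density j (θ, y))).const_mul g)).congr_deriv ?_
  have e1 : (freq j * f, g • v) = f • (freq j, (0 : Fin (n + 1) → ℂ)) + g • ((0 : ℝ), v) := by
    ext <;> simp [mul_comm]
  rw [e1, map_add, map_smul, map_smul, density]
  have hf : f ≠ 0 := hpos.ne'
  change f⁻¹ * _ - _ - g * (f⁻¹ * _) = 0
  simp only [smul_eq_mul]
  field_simp
  ring

/-- The measure in the flow box is infinitesimally invariant. -/
theorem hasDerivAt_integral_density (hn : 2 ≤ n) (j : Fin (n + 1)) (hΨ : LipschitzWith K Ψ)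
    (hB : ∀ x, |Ψ x| ≤ B)
    {φ : ℝ → EuclideanSpace ℂ (Fin (n + 1)) → EuclideanSpace ℂ (Fin (n + 1))}
    (h0 : ∀ x, φ 0 x = x) (hφ : ∀ x, HasDerivAt (fun s => φ s x) (field x) 0) {M : ℝ}
    (hM : ∀ s x, ‖φ s x - x‖ ≤ M * |s|) (hc : ∀ s, Continuous (φ s)) :
    HasDerivAt (fun s => ∫ ω in box n, density j ω * Ψ (φ s (chart j ω.1 ω.2))) 0 0 := by
  obtain ⟨L, hL0, hL⟩ := exists_norm_chart_sub_le j
  have hadd : ∀ s : ℝ, Continuous fun ω : ℝ × (Fin (n + 1) → ℂ) =>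
      Ψ (chart j (ω.1 + freq j * s) ω.2) := fun s =>
    (continuous_comp_chart j hΨ.continuous).comp
      (f := fun ω : ℝ × (Fin (n + 1) → ℂ) => (ω.1 + freq j * s, ω.2)) (by fun_prop)
  have hrot : ∀ s : ℝ, Continuous fun ω : ℝ × (Fin (n + 1) → ℂ) =>
      Ψ (chart j ω.1 (rot j s ω.2)) := fun s =>
    (continuous_comp_chart j hΨ.continuous).comp
      (f := fun ω : ℝ × (Fin (n + 1) → ℂ) => (ω.1, rot j s ω.2))
      (continuous_fst.prodMk ((continuous_rot j s).comp continuous_snd))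
  have i1 : ∀ s, IntegrableOn (fun ω => density j ω * Ψ (φ s (chart j ω.1 ω.2))) (box n) :=
    fun s => integrableOn_density_mul hn j
      (continuous_comp_chart j (hΨ.continuous.comp (hc s))) fun ω => hB _
  have i2 : ∀ s : ℝ, IntegrableOn (fun ω => Ψ (chart j (ω.1 + freq j * s) ω.2)) (box n) :=
    fun s => integrableOn_box (hadd s) fun ω => hB _
  have i3 : ∀ s : ℝ, IntegrableOn (fun ω => spin (excess j ω.2) ω.1 *
      (density j ω * Ψ (chart j ω.1 (rot j s ω.2)))) (box n) :=
    fun s => integrableOn_spin_mul hn j (hrot s) fun ω => hB _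
  let r : ℝ → ℝ × (Fin (n + 1) → ℂ) → ℝ := fun s ω =>
    density j ω * Ψ (φ s (chart j ω.1 ω.2)) - Ψ (chart j (ω.1 + freq j * s) ω.2) -
      spin (excess j ω.2) ω.1 * (density j ω * Ψ (chart j ω.1 (rot j s ω.2)))
  have ir : ∀ s, IntegrableOn (r s) (box n) := fun s => ((i1 s).sub (i2 s)).sub (i3 s)
  have hr : HasFDerivAt (fun s => ∫ ω in box n, r s ω)
      (∫ ω in box n, (0 : ℝ × (Fin (n + 1) → ℂ) → ℝ →L[ℝ] ℝ) ω) 0 := by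
    refine (hasFDerivAt_integral_of_dominated_loc_of_lip'
      (bound := fun ω => K * (M + 4 * L) * density j ω + K * L)
      (Metric.closedBall_mem_nhds (0 : ℝ) one_pos) (fun s _ => (ir s).aestronglyMeasurable)
      (ir 0) aestronglyMeasurable_zero ?_ ?_ ?_).2
    · filter_upwards [ae_restrict_mem measurableSet_box] with ω hω s hs
      obtain ⟨h1, h2⟩ := hL ω hω s hs
      have d0 := density_nonneg j ω
      have hsp : |spin (excess j ω.2) ω.1| ≤ 4 :=
        (abs_spin_le _ _).trans (norm_le_of_mem_box hω).1
      have e1 := (hΨ.norm_sub_le (φ s (chart j ω.1 ω.2)) (chart j ω.1 ω.2)).trans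
        (mul_le_mul_of_nonneg_left (hM s _) K.2)
      have e2 := (hΨ.norm_sub_le _ _).trans (mul_le_mul_of_nonneg_left h1 K.2)
      have e3 := (hΨ.norm_sub_le _ _).trans (mul_le_mul_of_nonneg_left h2 K.2)
      have : r s ω - r 0 ω =
          density j ω * (Ψ (φ s (chart j ω.1 ω.2)) - Ψ (chart j ω.1 ω.2)) -
          (Ψ (chart j (ω.1 + freq j * s) ω.2) - Ψ (chart j ω.1 ω.2)) -
          spin (excess j ω.2) ω.1 * (density j ω *
            (Ψ (chart j ω.1 (rot j s ω.2)) - Ψ (chart j ω.1 ω.2))) := by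
        simp only [r, h0, mul_zero, add_zero, rot_zero]; ring
      rw [this, sub_zero, Real.norm_eq_abs s]
      refine (norm_sub_le_of_le (norm_sub_le_of_le (norm_mul_le_of_le
        (Real.norm_of_nonneg d0).le e1) e2) (norm_mul_le_of_le hsp (norm_mul_le_of_le
        (Real.norm_of_nonneg d0).le e3))).trans (le_of_eq ?_)
      ring
    · exact ((integrableOn_density hn j).const_mul _).add
        (integrableOn_const (by exact volume_box_ne_top))
    · filter_upwards [ae_restrict_mem measurableSet_box,
        ae_restrict_of_ae (ae_speed_pos j), ae_restrict_of_ae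
        (ae_differentiableAt_comp_chart j hΨ)] with ω hω hpos hdiff
      have := (hasDerivAt_remainder hn j hΨ hω hpos (hdiff hω) (h0 _) (hφ _)).hasFDerivAt
      simpa using this
  have hr' : HasDerivAt (fun s => ∫ ω in box n, r s ω) 0 0 := by
    simpa using hr.hasDerivAt
  have heq : ∀ s, ∫ ω in box n, density j ω * Ψ (φ s (chart j ω.1 ω.2)) =
      (∫ ω in box n, r s ω) + ((∫ ω in box n, Ψ (chart j ω.1 ω.2)) +
        ∫ ω in box n, spin (excess j ω.2) ω.1 * (density j ω * Ψ (chart j ω.1 ω.2))) := fun s => by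
    have e1 := integral_sub ((i1 s).sub (i2 s)) (i3 s)
    have e2 := integral_sub (i1 s) (i2 s)
    have e3 := integral_chart_add j hΨ.continuous hB (freq j * s)
    have e4 := integral_chart_rot hn j hΨ.continuous s
    simp only [Pi.sub_apply] at e1
    linarith
  simp only [heq]
  exact hr'.add_const _

end

/-! ### The invariant measure -/

/-- A finite Borel measure is determined by the integrals of bounded Lipschitz functions. -/
theorem measure_eq_of_forall_lipschitz_integral_eq {Ω : Type*} [MeasurableSpace Ω]
    [PseudoEMetricSpace Ω] [BorelSpace Ω] {μ ν : Measure Ω} [IsFiniteMeasure μ] [IsFiniteMeasure ν]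
    (h : ∀ (K : ℝ≥0) (f : Ω → ℝ), LipschitzWith K f → (∀ x, |f x| ≤ 1) →
      ∫ x, f x ∂μ = ∫ x, f x ∂ν) : μ = ν := by
  have key : ∀ F : Set Ω, IsClosed F → μ F = ν F := fun F hF => by
    have hpos : ∀ k : ℕ, 0 < 1 / ((k : ℝ) + 1) := fun k => by positivity
    have hμ := tendsto_integral_thickenedIndicator_of_isClosed μ hF hpos
      tendsto_one_div_add_atTop_nhds_zero_nat
    have hν := tendsto_integral_thickenedIndicator_of_isClosed ν hF hpos
      tendsto_one_div_add_atTop_nhds_zero_nat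
    have heq : ∀ k, ∫ x, (thickenedIndicator (hpos k) F x : ℝ) ∂μ =
        ∫ x, (thickenedIndicator (hpos k) F x : ℝ) ∂ν := fun k =>
      h _ _ (lipschitzWith_thickenedIndicator (hpos k) F) fun x => by
        rw [abs_of_nonneg (NNReal.coe_nonneg _)]
        exact_mod_cast thickenedIndicator_le_one (hpos k) F x
    simp only [heq] at hμ
    exact (measureReal_eq_measureReal_iff).1 (tendsto_nhds_unique hμ hν)
  exact ext_of_generate_finite _
    (by rw [BorelSpace.measurable_eq (α := Ω), borel_eq_generateFrom_isClosed])
    isPiSystem_isClosed (fun F hF => key F hF) (key _ isClosed_univ)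

theorem continuous_chart (j : Fin (n + 1)) :
    Continuous fun ω : ℝ × (Fin (n + 1) → ℂ) => chart j ω.1 ω.2 := (contDiff_chart j).continuous

/-- The invariant measure carried by the flow box around the closed orbit `j`. -/
def boxMeasure (j : Fin (n + 1)) : Measure (EuclideanSpace ℂ (Fin (n + 1))) :=
  ((volume.restrict (box n)).withDensity fun ω => ENNReal.ofReal (density j ω)).map
    fun ω => chart j ω.1 ω.2

theorem isFiniteMeasure_boxMeasure (hn : 2 ≤ n) (j : Fin (n + 1)) :
    IsFiniteMeasure (boxMeasure j) := by
  have := isFiniteMeasure_withDensity_ofReal (integrableOn_density hn j).2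
  unfold boxMeasure
  infer_instance

theorem integral_boxMeasure (j : Fin (n + 1)) {Ψ : EuclideanSpace ℂ (Fin (n + 1)) → ℝ}
    (hΨ : Continuous Ψ) :
    ∫ z, Ψ z ∂boxMeasure j = ∫ ω in box n, density j ω * Ψ (chart j ω.1 ω.2) := by
  rw [boxMeasure, integral_map (continuous_chart j).aemeasurable hΨ.aestronglyMeasurable,
    integral_withDensity_eq_integral_toReal_smul (measurable_density j).ennreal_ofReal
      (Eventually.of_forall fun _ => ENNReal.ofReal_lt_top)]
  simp only [ENNReal.toReal_ofReal (density_nonneg j _), smul_eq_mul]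

section Invariance

variable {φ : ℝ → EuclideanSpace ℂ (Fin (n + 1)) → EuclideanSpace ℂ (Fin (n + 1))} {L : ℝ}

theorem norm_flow_sub_le (h0 : ∀ x, φ 0 x = x)
    (hφ : ∀ x t, HasDerivAt (fun τ => φ τ x) (field (φ t x)) t)
    (hL : ∀ x, ‖field (n := n) x‖ ≤ L) (t : ℝ) (x : EuclideanSpace ℂ (Fin (n + 1))) :
    ‖φ t x - x‖ ≤ L * |t| := by
  have := convex_univ.norm_image_sub_le_of_norm_hasDerivWithin_le (x := 0) (y := t)
    (fun s _ => (hφ x s).hasDerivWithinAt) (fun s _ => hL (φ s x)) trivial trivial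
  simpa [h0] using this

theorem integral_density_flow (hn : 2 ≤ n) (j : Fin (n + 1)) (h0 : ∀ x, φ 0 x = x)
    (hadd : ∀ s t x, φ (s + t) x = φ s (φ t x))
    (hφ : ∀ x t, HasDerivAt (fun τ => φ τ x) (field (φ t x)) t)
    (hlip : ∀ t, ∃ C, LipschitzWith C (φ t)) (hL : ∀ x, ‖field (n := n) x‖ ≤ L) {K : ℝ≥0}
    {Ψ : EuclideanSpace ℂ (Fin (n + 1)) → ℝ} (hΨ : LipschitzWith K Ψ) {B : ℝ}
    (hB : ∀ x, |Ψ x| ≤ B) (t : ℝ) :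
    ∫ ω in box n, density j ω * Ψ (φ t (chart j ω.1 ω.2)) =
      ∫ ω in box n, density j ω * Ψ (chart j ω.1 ω.2) := by
  set D : ℝ → ℝ := fun t => ∫ ω in box n, density j ω * Ψ (φ t (chart j ω.1 ω.2))
  have hD : ∀ t, HasDerivAt D 0 t := fun t => by
    obtain ⟨C, hC⟩ := hlip t
    have h := hasDerivAt_integral_density hn j (hΨ.comp hC) (fun x => hB (φ t x)) h0
      (fun x => by simpa [h0] using hφ x 0) (norm_flow_sub_le h0 hφ hL)
      fun s => (hlip s).choose_spec.continuous
    simp only [Function.comp, ← hadd] at h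
    have h' : HasDerivAt (fun s => D (t + s)) 0 (t - t) := by rwa [sub_self]
    simpa using h'.comp_sub_const t t
  have := is_const_of_deriv_eq_zero (fun t => (hD t).differentiableAt) (fun t => (hD t).deriv) t 0
  simpa only [D, h0] using this

theorem map_flow_boxMeasure (hn : 2 ≤ n) (j : Fin (n + 1)) (h0 : ∀ x, φ 0 x = x)
    (hadd : ∀ s t x, φ (s + t) x = φ s (φ t x))
    (hφ : ∀ x t, HasDerivAt (fun τ => φ τ x) (field (φ t x)) t)
    (hlip : ∀ t, ∃ C, LipschitzWith C (φ t)) (hL : ∀ x, ‖field (n := n) x‖ ≤ L) (t : ℝ) :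
    (boxMeasure j).map (φ t) = boxMeasure j := by
  have := isFiniteMeasure_boxMeasure hn j
  have hc : Continuous (φ t) := (hlip t).choose_spec.continuous
  refine measure_eq_of_forall_lipschitz_integral_eq fun K Ψ hΨ hB => ?_
  rw [integral_map hc.aemeasurable hΨ.continuous.aestronglyMeasurable,
    integral_boxMeasure j hΨ.continuous,
    integral_boxMeasure j (Ψ := fun z => Ψ (φ t z)) (hΨ.continuous.comp hc)]
  exact integral_density_flow hn j h0 hadd hφ hlip hL hΨ hB t

end Invariance

theorem mem_closure_box {θ : ℝ} {y : Fin (n + 1) → ℂ} (hθ : θ ∈ Ioc (-Real.pi) Real.pi)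
    (hy : ∀ i, ‖y i‖ ≤ 1) : (θ, y) ∈ closure (box n) := by
  rw [box, closure_prod_eq, closure_Ioo (by linarith [Real.pi_pos]),
    closure_ball _ one_ne_zero]
  exact ⟨Ioc_subset_Icc_self hθ, by
    simpa using (pi_norm_le_iff_of_nonneg zero_le_one).2 hy⟩

theorem boxMeasure_pos {j : Fin (n + 1)} {z : EuclideanSpace ℂ (Fin (n + 1))} (hz : ‖z‖ = 1)
    (hj : ∀ i, ‖z i‖ ≤ ‖z j‖) {U : Set (EuclideanSpace ℂ (Fin (n + 1)))} (hU : IsOpen U)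
    (hzU : z ∈ U) : 0 < boxMeasure j U := by
  have hzj : z j ≠ 0 := fun h => by
    have : z = 0 := by
      ext i
      simpa [h] using hj i
    simp [this] at hz
  set W : Set (ℝ × (Fin (n + 1) → ℂ)) := (fun ω => chart j ω.1 ω.2) ⁻¹' U
  have hW : IsOpen W := hU.preimage (continuous_chart j)
  have hmem : ((z j).arg, slow j z) ∈ W := by
    change chart j (z j).arg (slow j z) ∈ U
    rwa [chart_arg_slow hz hzj]
  have hne : (W ∩ box n).Nonempty := mem_closure_iff.1
    (mem_closure_box (Complex.arg_mem_Ioc _) (norm_slow_le hj)) W hW hmem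
  have hpos : volume (W ∩ box n) ≠ 0 := ((hW.inter isOpen_box).measure_pos volume hne).ne'
  rw [boxMeasure, Measure.map_apply (continuous_chart j).measurable hU.measurableSet,
    pos_iff_ne_zero, Ne, withDensity_apply_eq_zero (measurable_density j).ennreal_ofReal,
    Measure.restrict_apply' measurableSet_box]
  refine fun h => hpos (measure_mono_null_ae ?_ h)
  filter_upwards [ae_speed_pos j] with ω hω hωd
  exact ⟨⟨(ENNReal.ofReal_pos.2 (inv_pos.2 hω)).ne', hωd.1⟩, hωd.2⟩

/-- The invariant measure of the flow. -/
def flowMeasure (n : ℕ) : Measure (EuclideanSpace ℂ (Fin (n + 1))) := ∑ j, boxMeasure j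

theorem isFiniteMeasure_flowMeasure (hn : 2 ≤ n) : IsFiniteMeasure (flowMeasure n) := by
  have := fun j : Fin (n + 1) => isFiniteMeasure_boxMeasure hn j
  unfold flowMeasure
  infer_instance

theorem map_flow_flowMeasure (hn : 2 ≤ n)
    {φ : ℝ → EuclideanSpace ℂ (Fin (n + 1)) → EuclideanSpace ℂ (Fin (n + 1))} {L : ℝ}
    (h0 : ∀ x, φ 0 x = x) (hadd : ∀ s t x, φ (s + t) x = φ s (φ t x))
    (hφ : ∀ x t, HasDerivAt (fun τ => φ τ x) (field (φ t x)) t)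
    (hlip : ∀ t, ∃ C, LipschitzWith C (φ t)) (hL : ∀ x, ‖field (n := n) x‖ ≤ L) (t : ℝ) :
    (flowMeasure n).map (φ t) = flowMeasure n := by
  rw [flowMeasure, Measure.map_finset_sum' (hlip t).choose_spec.continuous.aemeasurable]
  exact Finset.sum_congr rfl fun j _ => map_flow_boxMeasure hn j h0 hadd hφ hlip hL t

theorem flowMeasure_pos {z : EuclideanSpace ℂ (Fin (n + 1))} (hz : ‖z‖ = 1)
    {U : Set (EuclideanSpace ℂ (Fin (n + 1)))} (hU : IsOpen U) (hzU : z ∈ U) :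
    0 < flowMeasure n U := by
  obtain ⟨j, hj⟩ := exists_forall_norm_le z
  rw [flowMeasure, Measure.finsetSum_apply]
  exact (boxMeasure_pos hz hj hU hzU).trans_le
    (Finset.single_le_sum (f := fun j => boxMeasure j U) (fun _ _ => zero_le) (Finset.mem_univ j))

theorem flowMeasure_compl_sphere : flowMeasure n (Metric.sphere 0 1)ᶜ = 0 := by
  rw [flowMeasure, Measure.finsetSum_apply]
  refine Finset.sum_eq_zero fun j _ => ?_
  rw [boxMeasure, Measure.map_apply (continuous_chart j).measurable
    Metric.isClosed_sphere.measurableSet.compl]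
  have : (fun ω : ℝ × (Fin (n + 1) → ℂ) => chart j ω.1 ω.2) ⁻¹' (Metric.sphere 0 1)ᶜ = ∅ := by
    ext ω
    simp [norm_chart]
  rw [this, measure_empty]

/-! ### Transfer to the real sphere -/

theorem norm_eq_of_hasDerivAt_field {γ : ℝ → EuclideanSpace ℂ (Fin (n + 1))}
    (h : ∀ t, HasDerivAt γ (field (γ t)) t) (s t : ℝ) : ‖γ s‖ = ‖γ t‖ := by
  have hd : ∀ t, HasDerivAt (fun t => ‖γ t‖ ^ 2) 0 t := fun t => by
    refine (h t).norm_sq.congr_deriv ?_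
    rw [real_inner_comm, inner_field, mul_zero]
  have := is_const_of_deriv_eq_zero (fun t => (hd t).differentiableAt) (fun t => (hd t).deriv) s t
  exact (pow_left_inj₀ (norm_nonneg _) (norm_nonneg _) two_ne_zero).1 this

theorem field_ne_zero (hn : 2 ≤ n) {z : EuclideanSpace ℂ (Fin (n + 1))} (hz : ‖z‖ = 1) :
    field z ≠ 0 := fun h =>
  not_periodic hn (γ := fun _ => z) (fun _ => hz) (fun t => by rw [h]; exact hasDerivAt_const t z)
    one_pos fun _ => rfl

/-- The identification of the complex with the real Euclidean space. -/
def realEquiv (n : ℕ) :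
    EuclideanSpace ℂ (Fin (n + 1)) ≃ₗᵢ[ℝ] EuclideanSpace ℝ (Fin (2 * n + 2)) :=
  ((stdOrthonormalBasis ℝ (EuclideanSpace ℂ (Fin (n + 1)))).reindex
    (finCongr (by rw [finrank_real_of_complex, finrank_euclideanSpace_fin]; ring))).repr

/-- The embedding of the real sphere into the complex Euclidean space. -/
def sphereEmb (n : ℕ) (x : Metric.sphere (0 : EuclideanSpace ℝ (Fin (2 * n + 2))) 1) :
    EuclideanSpace ℂ (Fin (n + 1)) := (realEquiv n).symm x

theorem norm_sphereEmb (x : Metric.sphere (0 : EuclideanSpace ℝ (Fin (2 * n + 2))) 1) :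
    ‖sphereEmb n x‖ = 1 := by
  rw [sphereEmb, LinearIsometryEquiv.norm_map]
  exact mem_sphere_zero_iff_norm.1 x.2

theorem isometry_sphereEmb : Isometry (sphereEmb n) :=
  (realEquiv n).symm.isometry.comp isometry_subtype_coe

theorem measurableEmbedding_sphereEmb : MeasurableEmbedding (sphereEmb n) :=
  isometry_sphereEmb.isClosedEmbedding.measurableEmbedding

theorem exists_sphereEmb_eq {z : EuclideanSpace ℂ (Fin (n + 1))} (hz : ‖z‖ = 1) :
    ∃ x, sphereEmb n x = z :=
  ⟨⟨realEquiv n z, by simpa using hz⟩, by simp [sphereEmb]⟩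

/-- The invariant measure on the real sphere. -/
def sphereMeasure (n : ℕ) : Measure (Metric.sphere (0 : EuclideanSpace ℝ (Fin (2 * n + 2))) 1) :=
  (flowMeasure n).comap (sphereEmb n)

theorem sphereMeasure_apply (s : Set (Metric.sphere (0 : EuclideanSpace ℝ (Fin (2 * n + 2))) 1)) :
    sphereMeasure n s = flowMeasure n (sphereEmb n '' s) :=
  measurableEmbedding_sphereEmb.comap_apply _ _

theorem isFiniteMeasure_sphereMeasure (hn : 2 ≤ n) : IsFiniteMeasure (sphereMeasure n) := by
  have := isFiniteMeasure_flowMeasure hn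
  exact ⟨by rw [sphereMeasure_apply]; exact measure_lt_top _ _⟩

theorem sphereMeasure_pos {U : Set (Metric.sphere (0 : EuclideanSpace ℝ (Fin (2 * n + 2))) 1)}
    (hU : IsOpen U) (hne : U.Nonempty) : 0 < sphereMeasure n U := by
  obtain ⟨x, hx⟩ := hne
  obtain ⟨O, hO, rfl⟩ := isometry_sphereEmb.isEmbedding.isOpen_iff.1 hU
  have hsub : O \ (Metric.sphere 0 1)ᶜ ⊆ sphereEmb n '' (sphereEmb n ⁻¹' O) := fun z hz => by
    obtain ⟨x, rfl⟩ := exists_sphereEmb_eq (mem_sphere_zero_iff_norm.1 (not_not.1 hz.2))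
    exact mem_image_of_mem _ hz.1
  have := flowMeasure_pos (norm_sphereEmb x) hO hx
  rw [← measure_sdiff_null (s := O) (flowMeasure_compl_sphere (n := n))] at this
  rw [sphereMeasure_apply]
  exact this.trans_le (measure_mono hsub)

end AperiodicSphere

end

/-- **Volume-preserving aperiodic flow on `S^{2n+1}`, `2n+1 ≥ 5`** (after Katok, via a
divergence-free Wilson plug): there is a smooth nonvanishing tangent vector field on
`S^{2n+1} ⊂ ℝ^{2n+2}` without periodic orbits, admitting a flow which preserves a finite
Borel measure positive on nonempty open sets. -/
theorem volume_preserving_aperiodic_flow_sphere (n : ℕ) (hn : 2 ≤ n) :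
    ∃ (X : EuclideanSpace ℝ (Fin (2 * n + 2)) → EuclideanSpace ℝ (Fin (2 * n + 2)))
      (φ : ℝ → Metric.sphere (0 : EuclideanSpace ℝ (Fin (2 * n + 2))) 1 →
        Metric.sphere (0 : EuclideanSpace ℝ (Fin (2 * n + 2))) 1)
      (μ : Measure (Metric.sphere (0 : EuclideanSpace ℝ (Fin (2 * n + 2))) 1)),
      ContDiff ℝ (⊤ : ℕ∞) X ∧
      (∀ x : EuclideanSpace ℝ (Fin (2 * n + 2)),
        x ∈ Metric.sphere (0 : EuclideanSpace ℝ (Fin (2 * n + 2))) 1 → ⟪X x, x⟫ = 0) ∧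
      (∀ x : EuclideanSpace ℝ (Fin (2 * n + 2)),
        x ∈ Metric.sphere (0 : EuclideanSpace ℝ (Fin (2 * n + 2))) 1 → X x ≠ 0) ∧
      (¬ ∃ γ : ℝ → EuclideanSpace ℝ (Fin (2 * n + 2)),
        (∀ t, γ t ∈ Metric.sphere (0 : EuclideanSpace ℝ (Fin (2 * n + 2))) 1) ∧
        (∀ t, HasDerivAt γ (X (γ t)) t) ∧
        (∃ T > 0, ∀ t, γ (t + T) = γ t) ∧ (∃ t s, γ t ≠ γ s)) ∧
      φ 0 = id ∧ (∀ s t, φ (s + t) = φ s ∘ φ t) ∧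
      (∀ (x : Metric.sphere (0 : EuclideanSpace ℝ (Fin (2 * n + 2))) 1) (t : ℝ),
        HasDerivAt (fun τ => (φ τ x : EuclideanSpace ℝ (Fin (2 * n + 2)))) (X (φ t x)) t) ∧
      IsFiniteMeasure μ ∧
      (∀ U : Set (Metric.sphere (0 : EuclideanSpace ℝ (Fin (2 * n + 2))) 1),
        IsOpen U → U.Nonempty → 0 < μ U) ∧
      (∀ t, MeasurePreserving (φ t) μ μ) := by
  obtain ⟨⟨K, hK⟩, L, hL⟩ := ContDiff.exists_lipschitz_bounded_of_hasCompactSupport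
    ((AperiodicSphere.contDiff_field (n := n)).of_le (by exact_mod_cast le_top))
    AperiodicSphere.hasCompactSupport_field
  obtain ⟨φ, h0, hadd, hφ, hlip⟩ := exists_flow_of_lipschitz_of_bounded hK hL
  have hnorm : ∀ t z, ‖φ t z‖ = ‖z‖ := fun t z => by
    rw [AperiodicSphere.norm_eq_of_hasDerivAt_field (hφ z) t 0, h0]
  set e := AperiodicSphere.realEquiv n
  let ψ : ℝ → Metric.sphere (0 : EuclideanSpace ℝ (Fin (2 * n + 2))) 1 →
      Metric.sphere (0 : EuclideanSpace ℝ (Fin (2 * n + 2))) 1 := fun t x =>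
    ⟨e (φ t (AperiodicSphere.sphereEmb n x)), by
      rw [mem_sphere_zero_iff_norm, e.norm_map, hnorm, AperiodicSphere.norm_sphereEmb]⟩
  have hψ : ∀ t x, AperiodicSphere.sphereEmb n (ψ t x) = φ t (AperiodicSphere.sphereEmb n x) :=
    fun t x => e.symm_apply_apply _
  have hinj := (AperiodicSphere.isometry_sphereEmb (n := n)).injective
  refine ⟨fun x => e (AperiodicSphere.field (e.symm x)), ψ, AperiodicSphere.sphereMeasure n,
    e.contDiff.comp (AperiodicSphere.contDiff_field.comp e.symm.contDiff), fun x _ => ?_,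
    fun x hx => ?_, ?_, ?_, fun s t => ?_, fun x t => ?_,
    AperiodicSphere.isFiniteMeasure_sphereMeasure hn, fun U => AperiodicSphere.sphereMeasure_pos,
    fun t => ⟨?_, ?_⟩⟩
  · rw [← e.symm.inner_map_map, e.symm_apply_apply, AperiodicSphere.inner_field]
  · simpa using AperiodicSphere.field_ne_zero hn (z := e.symm x) (by simpa using hx)
  · rintro ⟨γ, h1, hγ, ⟨T, hT, hp⟩, -⟩
    refine AperiodicSphere.not_periodic hn (γ := fun t => e.symm (γ t))
      (fun t => by simpa using h1 t) (fun t => ?_) hT fun t => by rw [hp]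
    exact (e.symm.toContinuousLinearEquiv.hasFDerivAt.comp_hasDerivAt t (hγ t)).congr_deriv
      (e.symm_apply_apply _)
  · exact funext fun x => hinj (by rw [hψ, h0, id])
  · exact funext fun x => hinj (by rw [Function.comp, hψ, hψ, hψ, hadd])
  · have := e.toContinuousLinearEquiv.hasFDerivAt.comp_hasDerivAt t
      (hφ (AperiodicSphere.sphereEmb n x) t)
    rw [← hψ] at this
    exact this
  · exact ((e.continuous.comp ((hlip t).choose_spec.continuous.comp
      AperiodicSphere.isometry_sphereEmb.continuous)).subtype_mk _).measurable
  · have hmeas : Measurable (ψ t) := ((e.continuous.comp ((hlip t).choose_spec.continuous.comp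
      AperiodicSphere.isometry_sphereEmb.continuous)).subtype_mk _).measurable
    ext s hs
    have himg : AperiodicSphere.sphereEmb n '' (ψ t ⁻¹' s) =
        φ t ⁻¹' (AperiodicSphere.sphereEmb n '' s) := by
      ext z
      constructor
      · rintro ⟨x, hx, rfl⟩
        exact ⟨ψ t x, hx, hψ t x⟩
      · rintro ⟨x, hx, hxz⟩
        obtain ⟨w, rfl⟩ := AperiodicSphere.exists_sphereEmb_eq (n := n) (z := z)
          (by rw [← hnorm t, ← hxz, AperiodicSphere.norm_sphereEmb])
        rw [← hψ] at hxz
        exact ⟨w, by rwa [Set.mem_preimage, ← hinj hxz], rfl⟩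
    rw [Measure.map_apply hmeas hs, AperiodicSphere.sphereMeasure_apply,
      AperiodicSphere.sphereMeasure_apply, himg,
      ← Measure.map_apply (hlip t).choose_spec.continuous.measurable
        (AperiodicSphere.measurableEmbedding_sphereEmb.measurableSet_image.2 hs),
      AperiodicSphere.map_flow_flowMeasure hn h0 hadd hφ hlip hL]
end

section
/- There exist a smooth tangent vector field X on the unit sphere S³ ⊂ ℝ⁴ with no zeros, and a flow φ : ℝ × S³ → S³ of X (φ₀ = id, φ_{s+t} = φ_s ∘ φ_t, with t ↦ φ_t(x) differentiable with derivative X(φ_t(x))) such that every φ_t preserves some finite Borel measure on S³ that is positive on every nonempty open subset, and X has only finitely many periodic orbits, i.e., the set of images of nonconstant periodic integral curves of X is finite and nonempty-or-empty but finite. (G. Kuperberg: every compact 3-manifold carries a volume-preserving C^∞ flow with a finite number of periodic orbits and no fixed points; stated here for S³.) -/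
open scoped RealInnerProductSpace
open MeasureTheory

/-- The double rotation of `ℝ⁴` by the angle `t` in the first coordinate plane and `√2 t` in the
second one. -/
noncomputable def doubleRotation (t : ℝ) (x : EuclideanSpace ℝ (Fin 4)) :
    EuclideanSpace ℝ (Fin 4) :=
  !₂[Real.cos t * x 0 - Real.sin t * x 1,
    Real.sin t * x 0 + Real.cos t * x 1,
    Real.cos (√2 * t) * x 2 - Real.sin (√2 * t) * x 3,
    Real.sin (√2 * t) * x 2 + Real.cos (√2 * t) * x 3]

/-- The velocity field of `doubleRotation`. -/
noncomputable def doubleRotationField (x : EuclideanSpace ℝ (Fin 4)) :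
    EuclideanSpace ℝ (Fin 4) :=
  !₂[-x 1, x 0, -(√2 * x 3), √2 * x 2]

theorem doubleRotation_zero (x : EuclideanSpace ℝ (Fin 4)) : doubleRotation 0 x = x := by
  ext i
  fin_cases i <;> simp [doubleRotation]

theorem doubleRotation_add (s t : ℝ) (x : EuclideanSpace ℝ (Fin 4)) :
    doubleRotation (s + t) x = doubleRotation s (doubleRotation t x) := by
  ext i
  fin_cases i <;> simp [doubleRotation, mul_add, Real.cos_add, Real.sin_add] <;> ring

theorem norm_doubleRotation (t : ℝ) (x : EuclideanSpace ℝ (Fin 4)) :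
    ‖doubleRotation t x‖ = ‖x‖ := by
  simp only [EuclideanSpace.norm_eq, Real.norm_eq_abs, sq_abs, Fin.sum_univ_four]
  congr 1
  simp only [doubleRotation, PiLp.toLp_apply, Matrix.cons_val]
  linear_combination (x 0 ^ 2 + x 1 ^ 2) * Real.sin_sq_add_cos_sq t +
    (x 2 ^ 2 + x 3 ^ 2) * Real.sin_sq_add_cos_sq (√2 * t)

/-- `doubleRotation` as a linear isometry. -/
noncomputable def doubleRotationIsometry (t : ℝ) :
    EuclideanSpace ℝ (Fin 4) ≃ₗᵢ[ℝ] EuclideanSpace ℝ (Fin 4) where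
  toFun := doubleRotation t
  invFun := doubleRotation (-t)
  map_add' x y := by
    ext i
    fin_cases i <;> simp [doubleRotation] <;> ring
  map_smul' c x := by
    ext i
    fin_cases i <;> simp [doubleRotation] <;> ring
  left_inv x := by rw [← doubleRotation_add, neg_add_cancel, doubleRotation_zero]
  right_inv x := by rw [← doubleRotation_add, add_neg_cancel, doubleRotation_zero]
  norm_map' := norm_doubleRotation t

theorem hasDerivAt_doubleRotation (x : EuclideanSpace ℝ (Fin 4)) (t : ℝ) :
    HasDerivAt (fun τ => doubleRotation τ x) (doubleRotationField (doubleRotation t x)) t := by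
  have h2 : HasDerivAt (fun τ : ℝ => √2 * τ) √2 t := by
    simpa using (hasDerivAt_id t).const_mul √2
  have key : ∀ i, HasDerivAt (fun τ => doubleRotation τ x i)
      (doubleRotationField (doubleRotation t x) i) t := by
    intro i
    fin_cases i
    · refine (((Real.hasDerivAt_cos t).mul_const (x 0)).sub
        ((Real.hasDerivAt_sin t).mul_const (x 1))).congr_deriv ?_
      simp [doubleRotationField, doubleRotation]
      ring
    · refine (((Real.hasDerivAt_sin t).mul_const (x 0)).add
        ((Real.hasDerivAt_cos t).mul_const (x 1))).congr_deriv ?_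
      simp [doubleRotationField, doubleRotation]
      ring
    · refine ((h2.cos.mul_const (x 2)).sub (h2.sin.mul_const (x 3))).congr_deriv ?_
      simp [doubleRotationField, doubleRotation]
      ring
    · refine ((h2.sin.mul_const (x 2)).add (h2.cos.mul_const (x 3))).congr_deriv ?_
      simp [doubleRotationField, doubleRotation]
      ring
  exact (PiLp.hasFDerivAt_toLp 2 _).comp_hasDerivAt t (hasDerivAt_pi.2 key)

theorem contDiff_doubleRotationField {n : WithTop ℕ∞} : ContDiff ℝ n doubleRotationField := by
  rw [contDiff_euclidean]
  intro i
  have h : ∀ j : Fin 4, ContDiff ℝ n fun x : EuclideanSpace ℝ (Fin 4) => x j :=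
    contDiff_euclidean.1 contDiff_id
  fin_cases i
  · exact (h 1).neg
  · exact h 0
  · exact (contDiff_const.mul (h 3)).neg
  · exact contDiff_const.mul (h 2)

theorem norm_doubleRotationField_sub_le (x y : EuclideanSpace ℝ (Fin 4)) :
    ‖doubleRotationField x - doubleRotationField y‖ ≤ √2 * ‖x - y‖ := by
  have h2 : √2 ^ 2 = (2 : ℝ) := Real.sq_sqrt (by norm_num)
  refine abs_le_of_sq_le_sq' ?_ (by positivity) |>.2
  simp only [mul_pow, h2, EuclideanSpace.norm_sq_eq, Real.norm_eq_abs, sq_abs, Fin.sum_univ_four]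
  simp only [doubleRotationField, PiLp.sub_apply, Matrix.cons_val]
  have e1 : (-(√2 * x 3) - -(√2 * y 3)) ^ 2 = 2 * (x 3 - y 3) ^ 2 := by
    linear_combination (x 3 - y 3) ^ 2 * h2
  have e2 : (√2 * x 2 - √2 * y 2) ^ 2 = 2 * (x 2 - y 2) ^ 2 := by
    linear_combination (x 2 - y 2) ^ 2 * h2
  rw [e1, e2]
  nlinarith [sq_nonneg (x 0 - y 0), sq_nonneg (x 1 - y 1)]

theorem eq_doubleRotation_of_hasDerivAt {γ : ℝ → EuclideanSpace ℝ (Fin 4)}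
    (hγ : ∀ t, HasDerivAt γ (doubleRotationField (γ t)) t) (t : ℝ) :
    γ t = doubleRotation t (γ 0) := by
  have hL : LipschitzWith (Real.toNNReal √2) doubleRotationField :=
    LipschitzWith.of_dist_le' fun x y => by
      simpa only [dist_eq_norm] using norm_doubleRotationField_sub_le x y
  exact congrFun (ODE_solution_unique_univ (v := fun _ => doubleRotationField)
    (s := fun _ => Set.univ) (t₀ := 0) (fun _ => hL.lipschitzOnWith)
    (fun t => ⟨hγ t, Set.mem_univ _⟩)
    (fun t => ⟨hasDerivAt_doubleRotation (γ 0) t, Set.mem_univ _⟩)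
    (doubleRotation_zero _).symm) t

theorem Real.cos_eq_one_of_rotation_fixed {θ a b : ℝ} (h₁ : cos θ * a - sin θ * b = a)
    (h₂ : sin θ * a + cos θ * b = b) (h : a ^ 2 + b ^ 2 ≠ 0) : cos θ = 1 := by
  apply mul_right_cancel₀ h
  linear_combination a * h₁ + b * h₂

theorem eq_zero_of_cos_eq_one_of_cos_sqrt_two_mul_eq_one {t : ℝ} (h₁ : Real.cos t = 1)
    (h₂ : Real.cos (√2 * t) = 1) : t = 0 := by
  obtain ⟨m, hm⟩ := (Real.cos_eq_one_iff _).1 h₁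
  obtain ⟨n, hn⟩ := (Real.cos_eq_one_iff _).1 h₂
  have hmn : √2 * m = n := by
    apply mul_right_cancel₀ Real.two_pi_pos.ne'
    rw [hn, ← hm]
    ring
  by_contra ht
  have hm0 : m ≠ 0 := by
    rintro rfl
    exact ht (by simpa using hm.symm)
  exact (irrational_sqrt_two.mul_intCast hm0).ne_int n hmn

theorem fst_or_snd_eq_zero_of_doubleRotation_eq_self {t : ℝ} {x : EuclideanSpace ℝ (Fin 4)}
    (ht : t ≠ 0) (h : doubleRotation t x = x) :
    (x 0 = 0 ∧ x 1 = 0) ∨ (x 2 = 0 ∧ x 3 = 0) := by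
  have h' : ∀ i, doubleRotation t x i = x i := fun i => by rw [h]
  by_contra! hx
  refine ht (eq_zero_of_cos_eq_one_of_cos_sqrt_two_mul_eq_one ?_ ?_)
  · refine Real.cos_eq_one_of_rotation_fixed (h' 0) (h' 1) fun h0 => hx.1 ?_ ?_ <;> nlinarith
  · refine Real.cos_eq_one_of_rotation_fixed (h' 2) (h' 3) fun h0 => hx.2 ?_ ?_ <;> nlinarith

theorem Real.exists_rotation_eq {a b c d : ℝ} (h₁ : a ^ 2 + b ^ 2 = 1) (h₂ : c ^ 2 + d ^ 2 = 1) :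
    ∃ θ, cos θ * a - sin θ * b = c ∧ sin θ * a + cos θ * b = d := by
  have hn : ‖(⟨a * c + b * d, a * d - b * c⟩ : ℂ)‖ = 1 := by
    rw [← sq_eq_sq₀ (norm_nonneg _) zero_le_one, Complex.sq_norm, Complex.normSq_mk]
    linear_combination (c ^ 2 + d ^ 2) * h₁ + h₂
  refine ⟨Complex.arg ⟨a * c + b * d, a * d - b * c⟩, ?_⟩
  rw [Complex.cos_arg (norm_pos_iff.1 (hn ▸ one_pos)), Complex.sin_arg, hn, div_one, div_one]
  constructor
  · linear_combination c * h₁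
  · linear_combination d * h₁

theorem sum_sq_eq_one_of_mem_sphere {x : EuclideanSpace ℝ (Fin 4)}
    (hx : x ∈ Metric.sphere (0 : EuclideanSpace ℝ (Fin 4)) 1) :
    x 0 ^ 2 + x 1 ^ 2 + x 2 ^ 2 + x 3 ^ 2 = 1 := by
  rw [mem_sphere_zero_iff_norm] at hx
  have := EuclideanSpace.norm_sq_eq x
  rw [hx] at this
  simpa [Fin.sum_univ_four] using this.symm

theorem range_doubleRotation_of_snd_eq_zero {x : EuclideanSpace ℝ (Fin 4)}
    (hx : x ∈ Metric.sphere (0 : EuclideanSpace ℝ (Fin 4)) 1) (h2 : x 2 = 0) (h3 : x 3 = 0) :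
    (Set.range fun t => doubleRotation t x) =
      {y ∈ Metric.sphere (0 : EuclideanSpace ℝ (Fin 4)) 1 | y 2 = 0 ∧ y 3 = 0} := by
  have hs := sum_sq_eq_one_of_mem_sphere hx
  ext y
  constructor
  · rintro ⟨t, rfl⟩
    refine ⟨?_, ?_, ?_⟩
    · rw [mem_sphere_zero_iff_norm] at hx ⊢
      rw [norm_doubleRotation, hx]
    all_goals simp [doubleRotation, h2, h3]
  · rintro ⟨hy, hy2, hy3⟩
    have hys := sum_sq_eq_one_of_mem_sphere hy
    obtain ⟨t, h₁, h₂⟩ := Real.exists_rotation_eq (a := x 0) (b := x 1) (c := y 0) (d := y 1)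
      (by simpa [h2, h3] using hs) (by simpa [hy2, hy3] using hys)
    refine ⟨t, ?_⟩
    ext i
    fin_cases i
    · exact h₁
    · exact h₂
    · simp [doubleRotation, h2, h3, hy2]
    · simp [doubleRotation, h2, h3, hy3]

theorem range_doubleRotation_of_fst_eq_zero {x : EuclideanSpace ℝ (Fin 4)}
    (hx : x ∈ Metric.sphere (0 : EuclideanSpace ℝ (Fin 4)) 1) (h0 : x 0 = 0) (h1 : x 1 = 0) :
    (Set.range fun t => doubleRotation t x) =
      {y ∈ Metric.sphere (0 : EuclideanSpace ℝ (Fin 4)) 1 | y 0 = 0 ∧ y 1 = 0} := by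
  have hs := sum_sq_eq_one_of_mem_sphere hx
  ext y
  constructor
  · rintro ⟨t, rfl⟩
    refine ⟨?_, ?_, ?_⟩
    · rw [mem_sphere_zero_iff_norm] at hx ⊢
      rw [norm_doubleRotation, hx]
    all_goals simp [doubleRotation, h0, h1]
  · rintro ⟨hy, hy0, hy1⟩
    have hys := sum_sq_eq_one_of_mem_sphere hy
    obtain ⟨t, h₁, h₂⟩ := Real.exists_rotation_eq (a := x 2) (b := x 3) (c := y 2) (d := y 3)
      (by simpa [h0, h1] using hs) (by simpa [hy0, hy1] using hys)
    have ht : √2 * (t / √2) = t := by field_simp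
    refine ⟨t / √2, ?_⟩
    ext i
    fin_cases i
    · simp [doubleRotation, h0, h1, hy0]
    · simp [doubleRotation, h0, h1, hy1]
    · simpa [doubleRotation, ht] using h₁
    · simpa [doubleRotation, ht] using h₂

open scoped Pointwise in
/-- The surface measure of the unit sphere is preserved by measure-preserving linear isometries. -/
theorem MeasureTheory.MeasurePreserving.toSphere {E : Type*} [NormedAddCommGroup E]
    [NormedSpace ℝ E] [MeasurableSpace E] [BorelSpace E] {μ : Measure E} {e : E ≃ₗᵢ[ℝ] E}
    (he : MeasurePreserving e μ μ) {f : Metric.sphere (0 : E) 1 → Metric.sphere (0 : E) 1}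
    (hf : ∀ x, (f x : E) = e x) : MeasurePreserving f μ.toSphere μ.toSphere := by
  have hfc : Continuous f := by
    refine Continuous.subtype_mk (f := fun x => (f x : E)) ?_ _
    simp_rw [hf]
    exact e.continuous.comp continuous_subtype_val
  refine ⟨hfc.measurable, Measure.ext fun s hs => ?_⟩
  rw [Measure.map_apply hfc.measurable hs, μ.toSphere_apply' (hfc.measurable hs),
    μ.toSphere_apply' hs]
  congr 1
  rw [← he.measure_preimage_equiv (f := e.toHomeomorph.toMeasurableEquiv)
    (Set.Ioo (0 : ℝ) 1 • (Subtype.val '' s))]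
  congr 1
  ext x
  simp only [Set.mem_smul, Set.mem_image, Set.mem_preimage]
  constructor
  · rintro ⟨r, hr, _, ⟨y, hy, rfl⟩, rfl⟩
    exact ⟨r, hr, _, ⟨f y, hy, rfl⟩, by simp [hf]⟩
  · rintro ⟨r, hr, _, ⟨y, hy, rfl⟩, hx⟩
    have hy' : e.symm y ∈ Metric.sphere (0 : E) 1 := by simp
    have hfy : f ⟨e.symm y, hy'⟩ = y := Subtype.ext (by simp [hf])
    refine ⟨r, hr, _, ⟨⟨e.symm y, hy'⟩, by simpa [hfy] using hy, rfl⟩, e.injective ?_⟩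
    simpa using hx

/-- **G. Kuperberg**: `S³` carries a smooth nonvanishing tangent vector field with only
finitely many periodic orbits, admitting a flow which preserves a finite Borel measure
positive on nonempty open sets. -/
theorem kuperberg_volume_preserving_finitely_many_orbits_S3 :
    ∃ (X : EuclideanSpace ℝ (Fin 4) → EuclideanSpace ℝ (Fin 4))
      (φ : ℝ → Metric.sphere (0 : EuclideanSpace ℝ (Fin 4)) 1 →
        Metric.sphere (0 : EuclideanSpace ℝ (Fin 4)) 1)
      (μ : Measure (Metric.sphere (0 : EuclideanSpace ℝ (Fin 4)) 1)),
      ContDiff ℝ (⊤ : ℕ∞) X ∧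
      (∀ x : EuclideanSpace ℝ (Fin 4),
        x ∈ Metric.sphere (0 : EuclideanSpace ℝ (Fin 4)) 1 → ⟪X x, x⟫ = 0) ∧
      (∀ x : EuclideanSpace ℝ (Fin 4),
        x ∈ Metric.sphere (0 : EuclideanSpace ℝ (Fin 4)) 1 → X x ≠ 0) ∧
      φ 0 = id ∧ (∀ s t, φ (s + t) = φ s ∘ φ t) ∧
      (∀ (x : Metric.sphere (0 : EuclideanSpace ℝ (Fin 4)) 1) (t : ℝ),
        HasDerivAt (fun τ => (φ τ x : EuclideanSpace ℝ (Fin 4))) (X (φ t x)) t) ∧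
      IsFiniteMeasure μ ∧
      (∀ U : Set (Metric.sphere (0 : EuclideanSpace ℝ (Fin 4)) 1),
        IsOpen U → U.Nonempty → 0 < μ U) ∧
      (∀ t, MeasurePreserving (φ t) μ μ) ∧
      {s : Set (EuclideanSpace ℝ (Fin 4)) | ∃ γ : ℝ → EuclideanSpace ℝ (Fin 4),
        (∀ t, γ t ∈ Metric.sphere (0 : EuclideanSpace ℝ (Fin 4)) 1) ∧
        (∀ t, HasDerivAt γ (X (γ t)) t) ∧
        (∃ T > 0, ∀ t, γ (t + T) = γ t) ∧ (∃ t s, γ t ≠ γ s) ∧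
        s = Set.range γ}.Finite := by
  refine ⟨doubleRotationField,
    fun t x => ⟨doubleRotation t x, by
      rw [mem_sphere_zero_iff_norm, norm_doubleRotation, norm_eq_of_mem_sphere]⟩,
    (volume : Measure (EuclideanSpace ℝ (Fin 4))).toSphere, contDiff_doubleRotationField,
    fun x _ => ?_, fun x hx h => ?_, ?_, fun s t => ?_, fun x t => hasDerivAt_doubleRotation x t,
    inferInstance, fun U hU hne => hU.measure_pos _ hne, fun t => ?_, ?_⟩
  · simp [doubleRotationField, PiLp.inner_apply, Fin.sum_univ_four]
    ring
  · have hs := sum_sq_eq_one_of_mem_sphere hx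
    have h' : ∀ i, doubleRotationField x i = 0 := fun i => by rw [h]; rfl
    have h0 := h' 0
    have h1 := h' 1
    have h2 := h' 2
    have h3 := h' 3
    simp [doubleRotationField] at h0 h1 h2 h3
    simp [h0, h1, h2, h3] at hs
  · funext x
    exact Subtype.ext (doubleRotation_zero x)
  · funext x
    exact Subtype.ext (doubleRotation_add s t x)
  · exact ((doubleRotationIsometry t).measurePreserving).toSphere fun _ => rfl
  · refine Set.Finite.subset (Set.toFinite
      {{y ∈ Metric.sphere (0 : EuclideanSpace ℝ (Fin 4)) 1 | y 0 = 0 ∧ y 1 = 0},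
        {y ∈ Metric.sphere (0 : EuclideanSpace ℝ (Fin 4)) 1 | y 2 = 0 ∧ y 3 = 0}}) ?_
    rintro _ ⟨γ, hγ, hd, ⟨T, hT, hper⟩, -, rfl⟩
    have hrot := eq_doubleRotation_of_hasDerivAt hd
    have hfix : doubleRotation T (γ 0) = γ 0 := by rw [← hrot, ← hper 0, zero_add]
    rw [funext hrot]
    rcases fst_or_snd_eq_zero_of_doubleRotation_eq_self hT.ne' hfix with ⟨h0, h1⟩ | ⟨h2, h3⟩
    · exact Or.inl (range_doubleRotation_of_fst_eq_zero (hγ 0) h0 h1)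
    · exact Or.inr (range_doubleRotation_of_snd_eq_zero (hγ 0) h2 h3)
end
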